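/- Let G(s) = \sum_{N=1}^{\infty} a_N N^{-s} be a Dirichlet series and let \rho > 0 and \beta > 0 be real numbers. Assume: (i) a_N \ge 0 for every N; (ii) G(s) converges for Re(s) > \rho; (iii) G(s) extends to an analytic function on the closed half-plane {Re(s) \ge \rho} with the possible exception of the single point s = \rho; (iv) there is an open neighborhood U of \rho and functions A(s), B(s) analytic on U such that G(s) = A(s)/(s-\rho)^{\beta} + B(s) for every s \in U with Re(s) > \rho (principal branch of (s-\rho)^{\beta}). Then, as x \to \infty, \sum_{N \le x} a_N = (A(\rho)/(\rho\,\Gamma(\beta)) + o(1))\, x^{\rho} (\log x)^{\beta - 1}; in particular, if A(\rho) = 0 then \sum_{N \le x} a_N = o(x^{\rho}(\log x)^{\beta-1}). -/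

import Mathlib

open Filter Topology

section

open MeasureTheory Set

/-- The Laplace transform of `x ^ β` at complex arguments with positive real part. -/
lemma integral_rpow_mul_cexp_neg_mul_Ioi {β : ℝ} (hβ : 0 < β) {z : ℂ} (hz : 0 < z.re) :
    ∫ x : ℝ in Ioi 0, ((x ^ β : ℝ) : ℂ) * Complex.exp (-z * x) =
      z ^ (-((β : ℂ) + 1)) * Complex.Gamma (β + 1) := by
  set ν : Measure ℝ := (volume.restrict (Ioi 0)).withDensity (fun x => ENNReal.ofReal (x ^ β))
    with hν
  have hmeas : Measurable (fun x : ℝ => x ^ β) := by fun_prop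
  have hcm (z : ℂ) : ProbabilityTheory.complexMGF id ν z =
      ∫ x : ℝ in Ioi 0, ((x ^ β : ℝ) : ℂ) * Complex.exp (z * x) := by
    rw [ProbabilityTheory.complexMGF, hν,
      integral_withDensity_eq_integral_toReal_smul (by fun_prop) (by simp)]
    refine setIntegral_congr_fun measurableSet_Ioi fun x hx => ?_
    simp only [id]
    rw [ENNReal.toReal_ofReal (Real.rpow_nonneg (le_of_lt hx) _), Complex.real_smul]
  have hset : Iio 0 ⊆ ProbabilityTheory.integrableExpSet id ν := by
    intro t ht
    have ht' : (0:ℝ) < -t := by simpa using ht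
    simp only [ProbabilityTheory.integrableExpSet, mem_ofPred_eq, hν, id]
    rw [integrable_withDensity_iff_integrable_smul' (by fun_prop) (by simp)]
    have := integrableOn_rpow_mul_exp_neg_mul_rpow (s := β) (p := 1) (by linarith) one_pos ht'
    refine this.congr_fun (fun x hx => ?_) measurableSet_Ioi
    simp only
    rw [ENNReal.toReal_ofReal (Real.rpow_nonneg (le_of_lt hx) _)]
    simp
  have hU : {z : ℂ | z.re < 0} ⊆
      {z : ℂ | z.re ∈ interior (ProbabilityTheory.integrableExpSet id ν)} := fun z hz =>
    interior_maximal hset isOpen_Iio hz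
  have han1 : AnalyticOnNhd ℂ (ProbabilityTheory.complexMGF id ν) {z : ℂ | z.re < 0} :=
    ProbabilityTheory.analyticOnNhd_complexMGF.mono hU
  have han2 : AnalyticOnNhd ℂ
      (fun z => (-z) ^ (-((β : ℂ) + 1)) * Complex.Gamma (β + 1)) {z : ℂ | z.re < 0} := by
    intro z hz
    have : -z ∈ Complex.slitPlane := Or.inl (by simpa using hz)
    have h1 : AnalyticAt ℂ (fun z : ℂ => -z) z := analyticAt_id.neg
    exact (h1.cpow analyticAt_const this).mul analyticAt_const
  have hreal (r : ℝ) (hr : 0 < r) : ProbabilityTheory.complexMGF id ν (-r : ℂ) =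
      (-(-r : ℂ)) ^ (-((β : ℂ) + 1)) * Complex.Gamma (β + 1) := by
    rw [hcm]
    have := Complex.integral_cpow_mul_exp_neg_mul_Ioi (a := β + 1) (r := r) (by simp; linarith) hr
    rw [neg_neg, Complex.cpow_neg]
    rw [one_div, Complex.inv_cpow _ _ (by
      rw [Complex.arg_ofReal_of_nonneg hr.le]; exact Real.pi_pos.ne)] at this
    rw [← this]
    refine setIntegral_congr_fun measurableSet_Ioi fun x hx => ?_
    rw [Complex.ofReal_cpow (le_of_lt hx)]
    simp
  have hfreq : ∃ᶠ w in 𝓝[≠] (-1 : ℂ), ProbabilityTheory.complexMGF id ν w =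
      (-w) ^ (-((β : ℂ) + 1)) * Complex.Gamma (β + 1) := by
    have ht : Tendsto (fun r : ℝ => (-r : ℂ)) (𝓝[≠] 1) (𝓝[≠] (-1)) := by
      refine tendsto_nhdsWithin_iff.2 ⟨?_, ?_⟩
      · have : Continuous (fun r : ℝ => (-r : ℂ)) := by fun_prop
        simpa using (this.tendsto 1).mono_left nhdsWithin_le_nhds
      · filter_upwards [self_mem_nhdsWithin] with r hr
        simp only [mem_compl_iff, mem_singleton_iff] at hr ⊢
        rw [neg_inj]; exact_mod_cast hr
    refine ht.frequently (Eventually.frequently ?_)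
    filter_upwards [mem_nhdsWithin_of_mem_nhds (lt_mem_nhds one_pos)] with r hr
    exact hreal r hr
  have := han1.eqOn_of_preconnected_of_frequently_eq han2
    (convex_halfSpace_re_lt 0).isPreconnected (z₀ := -1) (by simp) hfreq
  have h2 := this (show -z ∈ {z : ℂ | z.re < 0} by simpa using hz)
  simp only [neg_neg] at h2
  rw [← hcm, h2]

lemma integrable_one_add_mul_I_cpow {γ : ℝ} (hγ : 1 < γ) :
    Integrable (fun t : ℝ => (1 + t * Complex.I : ℂ) ^ (-(γ : ℂ))) := by
  have hne (t : ℝ) : (1 + t * Complex.I : ℂ) ∈ Complex.slitPlane := Or.inl (by simp)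
  have hcont : Continuous (fun t : ℝ => (1 + t * Complex.I : ℂ) ^ (-(γ : ℂ))) :=
    Continuous.cpow (by fun_prop) continuous_const hne
  have h1 : Integrable (fun t : ℝ => (1 + ‖t‖ ^ 2) ^ (-γ / 2)) :=
    integrable_rpow_neg_one_add_norm_sq (by simpa using hγ)
  refine h1.mono' hcont.aestronglyMeasurable (ae_of_all _ fun t => ?_)
  rw [← Complex.ofReal_neg, Complex.norm_cpow_real, Complex.norm_eq_sqrt_sq_add_sq, Real.sqrt_eq_rpow,
    ← Real.rpow_mul (by positivity)]
  simp only [Complex.add_re, Complex.one_re, Complex.mul_re, Complex.ofReal_re, Complex.I_re,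
    Complex.I_im, Complex.ofReal_im, Complex.add_im, Complex.one_im, Complex.mul_im]
  simp
  apply le_of_eq
  ring_nf

lemma integral_one_add_mul_I_cpow_mul_cexp {β : ℝ} (hβ : 0 < β) :
    ∫ t : ℝ, (1 + t * Complex.I : ℂ) ^ (-((β : ℂ) + 1)) * Complex.exp (t * Complex.I) =
      2 * Real.pi * Complex.exp (-1) / Complex.Gamma (β + 1) := by
  let h : ℝ → ℂ := (Ioi (0:ℝ)).indicator fun x => ((x ^ β : ℝ) : ℂ) * Complex.exp (-(1:ℂ) * x)
  have hΓ : Complex.Gamma (β + 1) ≠ 0 := Complex.Gamma_ne_zero_of_re_pos (by simp; linarith)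
  have hF : FourierTransform.fourier h = fun ξ : ℝ =>
      (1 + (2 * Real.pi * ξ : ℝ) * Complex.I : ℂ) ^ (-((β : ℂ) + 1)) * Complex.Gamma (β + 1) := by
    ext ξ
    rw [Real.fourier_real_eq_integral_exp_smul, ← integral_rpow_mul_cexp_neg_mul_Ioi hβ (by simp),
      ← integral_indicator measurableSet_Ioi]
    congr 1; ext x
    by_cases hx : x ∈ Ioi (0:ℝ)
    · simp only [h, indicator_of_mem hx, smul_eq_mul]
      rw [mul_left_comm, ← Complex.exp_add]
      congr 2; push_cast; ring
    · simp [h, indicator_of_notMem hx]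
  have hint : Integrable h := by
    rw [integrable_indicator_iff measurableSet_Ioi]
    have := integrableOn_rpow_mul_exp_neg_mul_rpow (s := β) (p := 1) (b := 1)
      (by linarith) one_pos one_pos
    refine (this.ofReal (𝕜 := ℂ)).congr (ae_of_all _ fun x => ?_)
    simp
  have hint2 : Integrable (FourierTransform.fourier h) := by
    rw [hF]
    have := (integrable_one_add_mul_I_cpow (γ := β + 1) (by linarith)).comp_mul_left'
      (R := 2 * Real.pi) (by positivity)
    simpa using this.mul_const (Complex.Gamma (β + 1))
  have hc : ContinuousAt h 1 := by
    have : h =ᶠ[𝓝 1] fun x => ((x ^ β : ℝ) : ℂ) * Complex.exp (-(1:ℂ) * x) := by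
      filter_upwards [lt_mem_nhds one_pos] with x hx
      simp only [h]
      exact indicator_of_mem (s := Ioi (0:ℝ)) hx _
    refine ContinuousAt.congr ?_ this.symm
    have : ContinuousAt (fun x : ℝ => x ^ β) 1 := Real.continuousAt_rpow_const _ _ (Or.inl one_ne_zero)
    fun_prop
  have key := hint.fourierInv_fourier_eq hint2 hc
  rw [Real.fourierInv_eq', hF] at key
  simp only [RCLike.inner_apply, conj_trivial, smul_eq_mul] at key
  have h1 : h 1 = Complex.exp (-1) := by
    simp [h]
  rw [h1] at key
  have hsub := Measure.integral_comp_mul_left 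
    (fun t : ℝ => (1 + t * Complex.I : ℂ) ^ (-((β : ℂ) + 1)) * Complex.exp (t * Complex.I))
    (2 * Real.pi)
  rw [← key, eq_div_iff hΓ]
  have h2 : (∫ v : ℝ, Complex.exp (((2 * Real.pi * (1 * v) : ℝ) : ℂ) * Complex.I) *
      ((1 + (2 * Real.pi * v : ℝ) * Complex.I : ℂ) ^ (-((β : ℂ) + 1)) * Complex.Gamma (β + 1))) =
      (∫ x : ℝ, (1 + ((2 * Real.pi * x : ℝ) : ℂ) * Complex.I : ℂ) ^ (-((β : ℂ) + 1)) *
        Complex.exp (((2 * Real.pi * x : ℝ) : ℂ) * Complex.I)) * Complex.Gamma (β + 1) := by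
    rw [← integral_mul_const]
    congr 1; ext x; rw [one_mul]; ring
  rw [h2, hsub, abs_of_pos (by positivity), Complex.real_smul]
  generalize ∫ y : ℝ, (1 + y * Complex.I : ℂ) ^ (-((β : ℂ) + 1)) * Complex.exp (y * Complex.I) = J
  push_cast
  field_simp

/-- The compactly supported function `(1 - |t|)₊ ^ 2`. -/
noncomputable def sqTent (t : ℝ) : ℝ := (max 0 (1 - |t|)) ^ 2

/-- The Fourier transform of `sqTent`, up to normalisation (see `integral_sqTent_mul_cexp`). -/
noncomputable def sqTentFourier (w : ℝ) : ℝ := 2 * ∫ t in (0:ℝ)..1, (1 - t) ^ 2 * Real.cos (w * t)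

lemma continuous_sqTent : Continuous sqTent := by unfold sqTent; fun_prop

lemma sqTent_neg (t : ℝ) : sqTent (-t) = sqTent t := by simp [sqTent]

lemma sqTent_eq_zero {t : ℝ} (ht : 1 ≤ |t|) : sqTent t = 0 := by
  simp [sqTent, max_eq_left (sub_nonpos.2 ht)]

lemma hasCompactSupport_sqTent : HasCompactSupport sqTent := by
  refine HasCompactSupport.of_support_subset_isCompact (isCompact_Icc (a := -1) (b := 1)) ?_
  intro t ht
  by_contra h
  refine ht (sqTent_eq_zero ?_)
  by_contra h2
  exact h (abs_le.1 (not_le.1 h2).le)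

lemma integral_sqTent_mul_cexp (w : ℝ) :
    ∫ t : ℝ, (sqTent t : ℂ) * Complex.exp (w * t * Complex.I) = sqTentFourier w := by
  have hc : Continuous fun t : ℝ => (sqTent t : ℂ) * Complex.exp (w * t * Complex.I) := by
    have := continuous_sqTent; fun_prop
  have h1 : ∫ t : ℝ, (sqTent t : ℂ) * Complex.exp (w * t * Complex.I) =
      ∫ t in (-1:ℝ)..1, (sqTent t : ℂ) * Complex.exp (w * t * Complex.I) := by
    rw [intervalIntegral.integral_eq_integral_of_support_subset]
    intro t ht
    have h2 : ¬ 1 ≤ |t| := fun h => ht (by simp [sqTent_eq_zero h])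
    have := abs_lt.1 (not_le.1 h2)
    exact ⟨this.1, this.2.le⟩
  have h2 := intervalIntegral.integral_comp_neg
    (f := fun t : ℝ => (sqTent t : ℂ) * Complex.exp (w * t * Complex.I)) (a := 0) (b := 1)
  rw [neg_zero] at h2
  rw [h1, ← intervalIntegral.integral_add_adjacent_intervals (b := 0) (hc.intervalIntegrable _ _)
    (hc.intervalIntegrable _ _), ← h2, ← intervalIntegral.integral_add]
  · rw [sqTentFourier, Complex.ofReal_mul, ← intervalIntegral.integral_ofReal,
      ← intervalIntegral.integral_const_mul]
    refine intervalIntegral.integral_congr fun t ht => ?_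
    rw [uIcc_of_le zero_le_one] at ht
    have h3 : sqTent t = (1 - t) ^ 2 := by
      rw [sqTent, abs_of_nonneg ht.1, max_eq_right (by linarith [ht.2])]
    simp only [sqTent_neg, h3]
    push_cast
    rw [Complex.cos]
    ring_nf
  · exact (hc.comp continuous_neg).intervalIntegrable _ _
  · exact hc.intervalIntegrable _ _

lemma continuous_sqTentFourier : Continuous sqTentFourier := by
  unfold sqTentFourier
  refine continuous_const.mul ?_
  refine intervalIntegral.continuous_parametric_intervalIntegral_of_continuous' ?_ _ _
  fun_prop

lemma sqTentFourier_neg (w : ℝ) : sqTentFourier (-w) = sqTentFourier w := by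
  simp [sqTentFourier]

lemma sqTentFourier_eq {w : ℝ} (hw : w ≠ 0) :
    sqTentFourier w = 4 * (w - Real.sin w) / w ^ 3 := by
  have h (t : ℝ) : HasDerivAt (fun t => (1 - t) ^ 2 * Real.sin (w * t) / w
      - 2 * (1 - t) * Real.cos (w * t) / w ^ 2 - 2 * Real.sin (w * t) / w ^ 3)
      ((1 - t) ^ 2 * Real.cos (w * t)) t := by
    have h1 : HasDerivAt (fun t : ℝ => 1 - t) (-1) t := (hasDerivAt_id t).const_sub 1
    have h2 : HasDerivAt (fun t : ℝ => w * t) w t := by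
      simpa using (hasDerivAt_id t).const_mul w
    have h3 := h2.sin
    have h4 := h2.cos
    have h5 := ((((h1.pow 2).mul h3).div_const w).sub
      (((h1.const_mul 2).mul h4).div_const (w ^ 2))).sub ((h3.const_mul 2).div_const (w ^ 3))
    refine (h5.congr_deriv ?_)
    simp
    field_simp
    ring
  rw [sqTentFourier, intervalIntegral.integral_eq_sub_of_hasDerivAt (fun t _ => h t)
    (Continuous.intervalIntegrable (by fun_prop) _ _)]
  simp
  field_simp
  ring

lemma sqTentFourier_pos (w : ℝ) : 0 < sqTentFourier w := by
  have hpos {w : ℝ} (hw : 0 < w) : 0 < sqTentFourier w := by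
    rw [sqTentFourier_eq hw.ne']
    have := Real.sin_lt hw
    have : 0 < w - Real.sin w := by linarith
    positivity
  rcases lt_trichotomy w 0 with h | h | h
  · rw [← sqTentFourier_neg]; exact hpos (by linarith)
  · subst h
    have h0 : sqTentFourier 0 = 2 / 3 := by
      rw [sqTentFourier]
      simp only [zero_mul, Real.cos_zero, mul_one]
      rw [intervalIntegral.integral_comp_sub_left (fun t : ℝ => t ^ 2)]
      simp; norm_num
    rw [h0]; norm_num
  · exact hpos h

lemma exists_bounds_sqTentFourier : ∃ κ > 0, ∃ C > 0, ∀ w : ℝ,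
    κ ≤ (1 + w ^ 2) * sqTentFourier w ∧ (1 + w ^ 2) * sqTentFourier w ≤ C := by
  have hc : ContinuousOn (fun w => (1 + w ^ 2) * sqTentFourier w) (Icc (-2) 2) := by
    have := continuous_sqTentFourier; fun_prop
  have hne : (Icc (-2:ℝ) 2).Nonempty := ⟨0, by simp⟩
  obtain ⟨a, -, ha⟩ := isCompact_Icc.exists_isMinOn hne hc
  obtain ⟨b, -, hb⟩ := isCompact_Icc.exists_isMaxOn hne hc
  have hlarge {w : ℝ} (hw : 2 ≤ w) :
      1 ≤ (1 + w ^ 2) * sqTentFourier w ∧ (1 + w ^ 2) * sqTentFourier w ≤ 10 := by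
    have hw0 : 0 < w := by linarith
    rw [sqTentFourier_eq hw0.ne', ← mul_div_assoc, le_div_iff₀ (by positivity),
      div_le_iff₀ (by positivity)]
    have h1 := Real.sin_le_one w
    have h2 := Real.neg_one_le_sin w
    constructor
    · nlinarith [mul_nonneg hw0.le (sq_nonneg w), mul_nonneg (sq_nonneg w) (sub_nonneg.2 h1),
        mul_nonneg (sq_nonneg w) (sub_nonneg.2 hw)]
    · have h3 : 0 ≤ 1 + Real.sin w := by linarith
      nlinarith [mul_nonneg (sq_nonneg w) h3, mul_nonneg (sq_nonneg w) (sub_nonneg.2 hw),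
        mul_nonneg hw0.le (sub_nonneg.2 hw)]
  refine ⟨min 1 ((1 + a ^ 2) * sqTentFourier a),
    lt_min one_pos (mul_pos (by positivity) (sqTentFourier_pos a)),
    max 10 ((1 + b ^ 2) * sqTentFourier b), lt_max_of_lt_left (by norm_num), fun w => ?_⟩
  by_cases hw : w ∈ Icc (-2:ℝ) 2
  · exact ⟨(min_le_right _ _).trans (ha hw), le_trans (hb hw) (le_max_right _ _)⟩
  · suffices 1 ≤ (1 + w ^ 2) * sqTentFourier w ∧ (1 + w ^ 2) * sqTentFourier w ≤ 10 from
      ⟨(min_le_left _ _).trans this.1, this.2.trans (le_max_left _ _)⟩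
    rcases lt_or_ge w (-2) with h | h
    · have := hlarge (w := -w) (by linarith)
      simpa [sqTentFourier_neg] using this
    · refine hlarge ?_
      by_contra h2
      exact hw ⟨h, by linarith⟩

lemma integrable_sqTentFourier : Integrable sqTentFourier := by
  obtain ⟨κ, -, C, -, h⟩ := exists_bounds_sqTentFourier
  refine (integrable_inv_one_add_sq.const_mul C).mono'
    continuous_sqTentFourier.aestronglyMeasurable (ae_of_all _ fun w => ?_)
  rw [Real.norm_of_nonneg (sqTentFourier_pos w).le, ← div_eq_mul_inv,
    le_div_iff₀ (by positivity), mul_comm]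
  exact (h w).2

lemma integral_sqTentFourier_mul_cexp (t : ℝ) :
    ∫ w : ℝ, (sqTentFourier w : ℂ) * Complex.exp (t * w * Complex.I) =
      2 * Real.pi * sqTent t := by
  have hint : Integrable (fun t => (sqTent t : ℂ)) :=
    (continuous_sqTent.integrable_of_hasCompactSupport hasCompactSupport_sqTent).ofReal
  have hF : FourierTransform.fourier (fun t => (sqTent t : ℂ)) =
      fun ξ : ℝ => (sqTentFourier (2 * Real.pi * ξ) : ℂ) := by
    ext ξ
    rw [Real.fourier_real_eq_integral_exp_smul, ← sqTentFourier_neg, ← integral_sqTent_mul_cexp]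
    congr 1; ext x
    rw [smul_eq_mul, mul_comm]
    congr 2; push_cast; ring
  have hint2 : Integrable (FourierTransform.fourier (fun t => (sqTent t : ℂ))) := by
    rw [hF]
    exact (integrable_sqTentFourier.comp_mul_left' (R := 2 * Real.pi) (by positivity)).ofReal
  have key := hint.fourierInv_fourier_eq hint2 (v := t)
    (Complex.continuous_ofReal.comp continuous_sqTent).continuousAt
  rw [Real.fourierInv_eq', hF] at key
  simp only [RCLike.inner_apply, conj_trivial, smul_eq_mul] at key
  have hsub := Measure.integral_comp_mul_left
    (fun w : ℝ => (sqTentFourier w : ℂ) * Complex.exp (t * w * Complex.I)) (2 * Real.pi)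
  have h2 : (∫ v : ℝ, Complex.exp (((2 * Real.pi * (t * v) : ℝ) : ℂ) * Complex.I) *
      (sqTentFourier (2 * Real.pi * v) : ℂ)) =
      ∫ v : ℝ, (sqTentFourier (2 * Real.pi * v) : ℂ) *
        Complex.exp (t * ((2 * Real.pi * v : ℝ) : ℂ) * Complex.I) := by
    congr 1; ext x; rw [mul_comm]; congr 2; push_cast; ring
  rw [← key, h2, hsub, abs_of_pos (by positivity), Complex.real_smul]
  generalize ∫ w : ℝ, (sqTentFourier w : ℂ) * Complex.exp (t * w * Complex.I) = J
  push_cast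
  field_simp

/-- **Lévy's continuity theorem** for finite measures on the line: pointwise convergence of the
characteristic functions implies convergence of the integrals of bounded continuous functions. -/
lemma tendsto_integral_of_tendsto_charFun {ι : Type*} {l : Filter ι} [l.IsCountablyGenerated]
    {P : ι → Measure ℝ} {Q : Measure ℝ} [∀ i, IsFiniteMeasure (P i)] [IsFiniteMeasure Q]
    (h : ∀ t : ℝ, Tendsto (fun i => charFun (P i) t) l (𝓝 (charFun Q t)))
    (f : BoundedContinuousFunction ℝ ℝ) :
    Tendsto (fun i => ∫ x, f x ∂(P i)) l (𝓝 (∫ x, f x ∂Q)) := by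
  refine tendsto_of_seq_tendsto fun v hv => ?_
  let N (μ : Measure ℝ) : Measure ℝ := ENNReal.ofReal (μ.real univ + 1)⁻¹ • (μ + Measure.dirac 0)
  have hpos (μ : Measure ℝ) : 0 < μ.real univ + 1 := by positivity
  have hN (μ : Measure ℝ) [IsFiniteMeasure μ] : IsProbabilityMeasure (N μ) := by
    constructor
    simp only [N, Measure.smul_apply, Measure.add_apply, smul_eq_mul, measure_univ]
    rw [← ENNReal.ofReal_toReal (measure_ne_top μ univ), ← ENNReal.ofReal_one,
      ← ENNReal.ofReal_add ENNReal.toReal_nonneg zero_le_one, ← ENNReal.ofReal_mul (by positivity)]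
    congr 1
    exact inv_mul_cancel₀ (hpos μ).ne'
  have hint {E : Type} [NormedAddCommGroup E] [NormedSpace ℝ E] [CompleteSpace E]
      (μ : Measure ℝ) [IsFiniteMeasure μ]
      (g : BoundedContinuousFunction ℝ E) [SecondCountableTopology E] [MeasurableSpace E]
      [BorelSpace E] :
      ∫ x, g x ∂(N μ) = (μ.real univ + 1)⁻¹ • (∫ x, g x ∂μ + g 0) := by
    rw [integral_smul_measure, integral_add_measure (g.integrable μ) (g.integrable _),
      integral_dirac, ENNReal.toReal_ofReal (inv_pos.2 (hpos μ)).le]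
  have hchar (μ : Measure ℝ) [IsFiniteMeasure μ] (t : ℝ) :
      charFun (N μ) t = (μ.real univ + 1)⁻¹ • (charFun μ t + 1) := by
    simp_rw [charFun_eq_integral_innerProbChar]
    rw [hint μ, BoundedContinuousFunction.innerProbChar_apply]
    simp
  have hmass : Tendsto (fun n => (P (v n)).real univ) atTop (𝓝 (Q.real univ)) := by
    have := (h 0).comp hv
    simp only [Function.comp_def, charFun_zero] at this
    exact_mod_cast (Complex.continuous_re.tendsto _).comp this
  have hinv := (hmass.add_const 1).inv₀ (hpos Q).ne'
  let p (n : ℕ) : ProbabilityMeasure ℝ := ⟨N (P (v n)), hN _⟩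
  let q : ProbabilityMeasure ℝ := ⟨N Q, hN _⟩
  have hpq : Tendsto p atTop (𝓝 q) := by
    refine ProbabilityMeasure.tendsto_iff_tendsto_charFun.2 fun t => ?_
    change Tendsto (fun n => charFun (N (P (v n))) t) atTop (𝓝 (charFun (N Q) t))
    simp_rw [hchar]
    exact hinv.smul (((h t).comp hv).add_const 1)
  have hf := ProbabilityMeasure.tendsto_iff_forall_integral_tendsto.1 hpq f
  change Tendsto (fun n => ∫ x, f x ∂(N (P (v n)))) atTop (𝓝 (∫ x, f x ∂(N Q))) at hf
  simp_rw [hint] at hf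
  have := ((hmass.add_const 1).smul hf).sub_const (f 0)
  simp only [smul_eq_mul, mul_inv_cancel_left₀ (hpos _).ne', add_sub_cancel_right] at this
  exact this

lemma exists_eventually_norm_le_of_cpow_singularity {L A B : ℂ → ℂ} {β : ℝ} (hβ : 0 < β)
    (hA : AnalyticAt ℂ A 0) (hB : AnalyticAt ℂ B 0)
    (hAB : ∀ᶠ z : ℂ in 𝓝 0, 0 < z.re → L z = A z / z ^ (β : ℂ) + B z) :
    ∃ C : ℝ, ∀ᶠ z : ℂ in 𝓝 0, 0 < z.re → ‖L z‖ ≤ C * ‖z‖ ^ (-β) ∧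
      ‖deriv L z + β * A 0 * z ^ (-((β : ℂ) + 1))‖ ≤ C * ‖z‖ ^ (-β) := by
  have hbd {f : ℂ → ℂ} (hf : AnalyticAt ℂ f 0) : ∀ᶠ z in 𝓝 0, ‖f z‖ < ‖f 0‖ + 1 :=
    hf.continuousAt.norm.eventually (gt_mem_nhds (lt_add_one _))
  obtain ⟨M, hM0, hM⟩ := hA.differentiableAt.isBigO_sub.exists_pos
  refine ⟨(‖A 0‖ + 1 + (‖B 0‖ + 1)) + ((‖deriv A 0‖ + 1) + β * M + (‖deriv B 0‖ + 1)), ?_⟩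
  filter_upwards [hbd hA, hbd hB, hbd hA.deriv, hbd hB.deriv, hM.bound, hAB.eventually_nhds,
    hA.eventually_analyticAt, hB.eventually_analyticAt,
    Metric.closedBall_mem_nhds (0:ℂ) one_pos] with z h1 h2 h3 h4 h5 h6 h7 h8 h9 hz
  have hz0 : z ≠ 0 := by rintro rfl; simp at hz
  have hzs : z ∈ Complex.slitPlane := Or.inl hz
  have hn : 0 < ‖z‖ := norm_pos_iff.2 hz0
  have hz1 : ‖z‖ ≤ 1 := by simpa using h9
  have hp1 : 1 ≤ ‖z‖ ^ (-β) := Real.one_le_rpow_of_pos_of_le_one_of_nonpos hn hz1 (by linarith)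
  have hL : L =ᶠ[𝓝 z] fun w => A w * w ^ (-(β : ℂ)) + B w := by
    filter_upwards [h6, (isOpen_lt continuous_const Complex.continuous_re).mem_nhds hz] with w hw hw2
    rw [hw hw2, Complex.cpow_neg, div_eq_mul_inv]
  have hd := ((h7.differentiableAt.hasDerivAt.mul
    ((hasDerivAt_id z).cpow_const (c := -(β : ℂ)) hzs)).add h8.differentiableAt.hasDerivAt)
  have hdL := (hd.congr_of_eventuallyEq hL).deriv
  have hnc : ‖z ^ (-(β : ℂ))‖ = ‖z‖ ^ (-β) := by
    rw [← Complex.ofReal_neg, Complex.norm_cpow_real]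
  have hnc1 : ‖z ^ (-((β : ℂ) + 1))‖ = ‖z‖ ^ (-β) / ‖z‖ := by
    rw [show (-((β : ℂ) + 1)) = ((-(β + 1) : ℝ) : ℂ) by push_cast; ring, Complex.norm_cpow_real,
      neg_add', Real.rpow_sub_one hn.ne']
  set P := ‖z‖ ^ (-β)
  have hA0 := norm_nonneg (A 0)
  have hB0 := norm_nonneg (B 0)
  have hA1 := norm_nonneg (deriv A 0)
  have hB1 := norm_nonneg (deriv B 0)
  have hP : 0 ≤ P := by linarith
  have hβM : 0 ≤ β * M := by positivity
  have hBz : ‖B z‖ ≤ (‖B 0‖ + 1) * P :=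
    h2.le.trans (le_mul_of_one_le_right (by positivity) hp1)
  have hBz' : ‖deriv B z‖ ≤ (‖deriv B 0‖ + 1) * P :=
    h4.le.trans (le_mul_of_one_le_right (by positivity) hp1)
  constructor
  · rw [hL.eq_of_nhds]
    calc _ ≤ ‖A z‖ * P + ‖B z‖ := by
          refine (norm_add_le _ _).trans ?_
          rw [norm_mul, hnc]
      _ ≤ (‖A 0‖ + 1) * P + (‖B 0‖ + 1) * P :=
          add_le_add (by gcongr) hBz
      _ ≤ _ := by
          rw [← add_mul]
          exact mul_le_mul_of_nonneg_right (by linarith) hP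
  · have hsplit : deriv L z + β * A 0 * z ^ (-((β : ℂ) + 1)) =
        deriv A z * z ^ (-(β : ℂ)) - β * (A z - A 0) * z ^ (-((β : ℂ) + 1)) + deriv B z := by
      rw [hdL, neg_add']
      simp only [id]
      ring
    rw [hsplit]
    have h5' : ‖A z - A 0‖ ≤ M * ‖z‖ := by simpa using h5
    calc _ ≤ ‖deriv A z‖ * P + β * ‖A z - A 0‖ * (P / ‖z‖) + ‖deriv B z‖ := by
          refine (norm_add_le _ _).trans ?_
          gcongr
          refine (norm_sub_le _ _).trans ?_
          rw [norm_mul, norm_mul, norm_mul, hnc, hnc1, Complex.norm_real, Real.norm_of_nonneg hβ.le]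
      _ ≤ (‖deriv A 0‖ + 1) * P + β * (M * ‖z‖) * (P / ‖z‖) + (‖deriv B 0‖ + 1) * P :=
          add_le_add (by gcongr) hBz'
      _ = ((‖deriv A 0‖ + 1) + β * M + (‖deriv B 0‖ + 1)) * P := by
          field_simp
      _ ≤ _ := mul_le_mul_of_nonneg_right (by linarith) hP

lemma exists_norm_le_of_cpow_singularity {L A B : ℂ → ℂ} {β : ℝ} (hβ : 0 < β)
    (hL : ∀ z : ℂ, 0 ≤ z.re → z ≠ 0 → AnalyticAt ℂ L z)
    (hA : AnalyticAt ℂ A 0) (hB : AnalyticAt ℂ B 0)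
    (hAB : ∀ᶠ z : ℂ in 𝓝 0, 0 < z.re → L z = A z / z ^ (β : ℂ) + B z) (R : ℝ) :
    ∃ C : ℝ, ∀ z : ℂ, 0 < z.re → z.re ≤ 1 → |z.im| ≤ R → ‖L z‖ ≤ C * ‖z‖ ^ (-β) ∧
      ‖deriv L z + β * A 0 * z ^ (-((β : ℂ) + 1))‖ ≤ C * ‖z‖ ^ (-β) := by
  obtain ⟨C₁, hC₁⟩ := exists_eventually_norm_le_of_cpow_singularity hβ hA hB hAB
  obtain ⟨δ, hδ, hball⟩ := Metric.eventually_nhds_iff_ball.1 hC₁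
  let S : Set ℂ := (Icc 0 1 ×ℂ Icc (-R) R) \ Metric.ball 0 δ
  have hS : IsCompact S := (isCompact_Icc.reProdIm isCompact_Icc).diff Metric.isOpen_ball
  have hS0 {z : ℂ} (hz : z ∈ S) : 0 ≤ z.re ∧ z ≠ 0 :=
    ⟨(Complex.mem_reProdIm.1 hz.1).1.1, fun h => hz.2 (by simpa [h] using hδ)⟩
  have hslit {z : ℂ} (hz : z ∈ S) : z ∈ Complex.slitPlane := by
    obtain ⟨h1, h2⟩ := hS0 hz
    rcases h1.lt_or_eq with h | h
    · exact Or.inl h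
    · exact Or.inr fun h3 => h2 (Complex.ext h.symm h3)
  have hpow : ContinuousOn (fun z : ℂ => ‖z‖ ^ β) S :=
    (continuous_norm.rpow_const fun _ => Or.inr hβ.le).continuousOn
  have hc1 : ContinuousOn (fun z => ‖L z‖ * ‖z‖ ^ β) S :=
    ContinuousOn.mul (fun z hz =>
      (hL z (hS0 hz).1 (hS0 hz).2).continuousAt.norm.continuousWithinAt) hpow
  have hc2 : ContinuousOn
      (fun z => ‖deriv L z + β * A 0 * z ^ (-((β : ℂ) + 1))‖ * ‖z‖ ^ β) S := by
    refine ContinuousOn.mul (fun z hz => ContinuousAt.continuousWithinAt ?_) hpow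
    refine ((hL z (hS0 hz).1 (hS0 hz).2).deriv.continuousAt.add ?_).norm
    exact continuousAt_const.mul (continuousAt_id.cpow continuousAt_const (hslit hz))
  obtain ⟨C₂, hC₂⟩ := hS.bddAbove_image hc1
  obtain ⟨C₃, hC₃⟩ := hS.bddAbove_image hc2
  refine ⟨max C₁ (max C₂ C₃), fun z h0 h1 h2 => ?_⟩
  have hn : 0 < ‖z‖ := norm_pos_iff.2 (by rintro rfl; simp at h0)
  have hpn := Real.rpow_nonneg hn.le (-β)
  by_cases hz : z ∈ Metric.ball 0 δ
  · obtain ⟨h3, h4⟩ := hball z hz h0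
    have := mul_le_mul_of_nonneg_right (le_max_left C₁ (max C₂ C₃)) hpn
    exact ⟨h3.trans this, h4.trans this⟩
  · have hzS : z ∈ S := ⟨Complex.mem_reProdIm.2 ⟨⟨h0.le, h1⟩, abs_le.1 h2⟩, hz⟩
    have h3 := hC₂ (mem_image_of_mem _ hzS)
    have h4 := hC₃ (mem_image_of_mem _ hzS)
    have hp : 0 < ‖z‖ ^ β := Real.rpow_pos_of_pos hn _
    rw [Real.rpow_neg hn.le, ← div_eq_mul_inv, le_div_iff₀ hp, le_div_iff₀ hp]
    exact ⟨h3.trans ((le_max_left _ _).trans (le_max_right _ _)),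
      h4.trans ((le_max_right _ _).trans (le_max_right _ _))⟩

lemma ofReal_mul_cpow_ofReal {r : ℝ} (hr : 0 < r) {z : ℂ} (hz : z ≠ 0) (c : ℝ) :
    ((r : ℂ) * z) ^ (c : ℂ) = ((r ^ c : ℝ) : ℂ) * z ^ (c : ℂ) := by
  have hr' : (r : ℂ) ≠ 0 := by exact_mod_cast hr.ne'
  rw [Complex.cpow_def_of_ne_zero (mul_ne_zero hr' hz), Complex.cpow_def_of_ne_zero hz,
    Complex.log_ofReal_mul hr hz, Complex.ofReal_cpow hr.le, Complex.cpow_def_of_ne_zero hr',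
    ← Complex.exp_add, Complex.ofReal_log hr.le, add_mul]

lemma inv_add_mul_I_eq {u : ℝ} (hu : 0 < u) (t : ℝ) :
    ((u⁻¹ : ℝ) : ℂ) + t * Complex.I = ((u⁻¹ : ℝ) : ℂ) * (1 + ((u * t : ℝ) : ℂ) * Complex.I) := by
  have : (u : ℂ) ≠ 0 := by exact_mod_cast hu.ne'
  push_cast
  field_simp

lemma one_add_mul_I_ne_zero (t : ℝ) : (1 + t * Complex.I : ℂ) ≠ 0 := fun h => by
  simpa using congrArg Complex.re h

lemma continuous_one_add_mul_I_cpow (c : ℂ) :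
    Continuous (fun t : ℝ => (1 + t * Complex.I : ℂ) ^ c) :=
  Continuous.cpow (by fun_prop) continuous_const fun _ => Or.inl (by simp)

lemma tendsto_integral_cpow_main {β : ℝ} (hβ : 0 < β) {Φ : ℝ → ℝ} (hΦ : Continuous Φ) {M R : ℝ}
    (hM : ∀ t, |Φ t| ≤ M) (hR : ∀ t, R ≤ |t| → Φ t = 0) :
    Tendsto (fun u : ℝ => ((u ^ (-β) : ℝ) : ℂ) * ∫ t in (-R)..R,
        (Φ t : ℂ) * (((u⁻¹ : ℝ) : ℂ) + t * Complex.I) ^ (-((β : ℂ) + 1)) *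
          Complex.exp (t * u * Complex.I)) atTop
      (𝓝 (Φ 0 * ∫ t : ℝ, (1 + t * Complex.I : ℂ) ^ (-((β : ℂ) + 1)) *
        Complex.exp (t * Complex.I))) := by
  let h (u τ : ℝ) : ℂ := (Φ (u⁻¹ * τ) : ℂ) *
    ((1 + τ * Complex.I : ℂ) ^ (-((β : ℂ) + 1)) * Complex.exp (τ * Complex.I))
  have hint : Integrable (fun t : ℝ => (1 + t * Complex.I : ℂ) ^ (-((β : ℂ) + 1))) := by
    simpa using integrable_one_add_mul_I_cpow (γ := β + 1) (by linarith)
  have hlim : Tendsto (fun u : ℝ => ∫ τ, h u τ) atTop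
      (𝓝 (∫ t : ℝ, (Φ 0 : ℂ) * ((1 + t * Complex.I : ℂ) ^ (-((β : ℂ) + 1)) *
        Complex.exp (t * Complex.I)))) := by
    refine tendsto_integral_filter_of_dominated_convergence
      (fun t => M * ‖(1 + t * Complex.I : ℂ) ^ (-((β : ℂ) + 1))‖) (Eventually.of_forall fun u => ?_)
      (Eventually.of_forall fun u => ae_of_all _ fun t => ?_) (hint.norm.const_mul M)
      (ae_of_all _ fun t => ?_)
    · have := continuous_one_add_mul_I_cpow (-((β : ℂ) + 1))
      exact Continuous.aestronglyMeasurable (by fun_prop)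
    · rw [norm_mul, norm_mul, Complex.norm_exp_ofReal_mul_I, mul_one, Complex.norm_real]
      gcongr
      exact hM _
    · refine Tendsto.mul_const _ ?_
      have h1 : Tendsto (fun u : ℝ => u⁻¹ * t) atTop (𝓝 0) := by
        simpa using tendsto_inv_atTop_zero.mul_const t
      exact (Complex.continuous_ofReal.tendsto _).comp ((hΦ.tendsto 0).comp h1)
  rw [← integral_const_mul]
  refine hlim.congr' ?_
  filter_upwards [eventually_gt_atTop 0] with u hu
  have hsupp : Function.support (fun t : ℝ =>
      (Φ t : ℂ) * (((u⁻¹ : ℝ) : ℂ) + t * Complex.I) ^ (-((β : ℂ) + 1)) *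
          Complex.exp (t * u * Complex.I)) ⊆ Ioc (-R) R := by
    intro t ht
    have h2 : ¬ R ≤ |t| := fun h => ht (by simp [hR t h])
    have := abs_lt.1 (not_le.1 h2)
    exact ⟨this.1, this.2.le⟩
  rw [intervalIntegral.integral_eq_integral_of_support_subset hsupp, ← integral_const_mul]
  have hsub := Measure.integral_comp_mul_left (h u) u
  rw [abs_of_pos (inv_pos.2 hu), eq_inv_smul_iff₀ hu.ne'] at hsub
  rw [← hsub, Complex.real_smul, ← integral_const_mul]
  congr 1; ext t
  have he : (-((β : ℂ) + 1)) = ((-(β + 1) : ℝ) : ℂ) := by push_cast; ring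
  simp only [h]
  rw [inv_mul_cancel_left₀ hu.ne', inv_add_mul_I_eq hu, he,
    ofReal_mul_cpow_ofReal (inv_pos.2 hu) (one_add_mul_I_ne_zero _)]
  have h3 : (u : ℂ) = ((u ^ (-β) : ℝ) : ℂ) * ((u⁻¹ ^ (-(β + 1)) : ℝ) : ℂ) := by
    rw [← Complex.ofReal_mul, Real.inv_rpow hu.le, ← Real.rpow_neg hu.le, ← Real.rpow_add hu]
    norm_num
  nth_rewrite 1 [h3]
  push_cast
  rw [mul_comm (u : ℂ) t]
  ring

lemma tendsto_integral_cpow_error {β : ℝ} (hβ : 0 < β) {E : ℝ → ℝ → ℂ} {C R : ℝ}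
    (hR0 : 0 ≤ R)
    (hmeas : ∀ u, 1 ≤ u → AEStronglyMeasurable (E u) (volume.restrict (Set.uIoc (-R) R)))
    (hE : ∀ u, 1 ≤ u → ∀ t, |t| ≤ R → ‖E u t‖ ≤ C * ‖((u⁻¹ : ℝ) : ℂ) + t * Complex.I‖ ^ (-β)) :
    Tendsto (fun u : ℝ => ((u ^ (-β) : ℝ) : ℂ) * ∫ t in (-R)..R, E u t) atTop (𝓝 0) := by
  have key : ∀ u, 1 ≤ u → ∀ t, |t| ≤ R → ‖((u ^ (-β) : ℝ) : ℂ) * E u t‖ ≤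
      C * ‖(1 + ((u * t : ℝ) : ℂ) * Complex.I)‖ ^ (-β) := by
    intro u hu t ht
    have hu0 : 0 < u := by linarith
    have h1 := hE u hu t ht
    rw [inv_add_mul_I_eq hu0, norm_mul, Complex.norm_real, Real.norm_of_nonneg (by positivity),
      Real.mul_rpow (by positivity) (norm_nonneg _), Real.inv_rpow hu0.le] at h1
    rw [norm_mul, Complex.norm_real, Real.norm_of_nonneg (by positivity)]
    refine (mul_le_mul_of_nonneg_left h1 (by positivity)).trans (le_of_eq ?_)
    have : u ^ (-β) ≠ 0 := (Real.rpow_pos_of_pos hu0 _).ne'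
    field_simp
  have hC : 0 ≤ C := by
    have := key 1 le_rfl 0 (by simpa using hR0)
    simp at this
    exact (norm_nonneg _).trans this
  have hone (x : ℝ) : 1 ≤ ‖(1 + (x : ℂ) * Complex.I)‖ := by
    have := Complex.abs_re_le_norm (1 + (x : ℂ) * Complex.I)
    simpa using this
  simp_rw [← intervalIntegral.integral_const_mul]
  have := intervalIntegral.tendsto_integral_filter_of_dominated_convergence (μ := volume)
    (l := atTop) (F := fun u t => ((u ^ (-β) : ℝ) : ℂ) * E u t) (f := fun _ => 0) (a := -R) (b := R)
    (fun _ => C) ?_ ?_ (by simp) ?_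
  · simpa using this
  · filter_upwards [eventually_ge_atTop 1] with u hu
    exact (hmeas u hu).const_mul _
  · filter_upwards [eventually_ge_atTop 1] with u hu
    refine ae_of_all _ fun t ht => ?_
    rw [uIoc_of_le (by linarith)] at ht
    refine (key u hu t (abs_le.2 ⟨ht.1.le, ht.2⟩)).trans ?_
    refine mul_le_of_le_one_right hC ?_
    exact Real.rpow_le_one_of_one_le_of_nonpos (hone _) (by linarith)
  · have h0 : ∀ᵐ t : ℝ, t ≠ 0 := by simp [ae_iff]
    filter_upwards [h0] with t ht0 ht
    rw [uIoc_of_le (by linarith)] at ht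
    refine squeeze_zero_norm' (a := fun u => C * ‖(1 + ((u * t : ℝ) : ℂ) * Complex.I)‖ ^ (-β)) ?_ ?_
    · filter_upwards [eventually_ge_atTop 1] with u hu
      exact key u hu t (abs_le.2 ⟨ht.1.le, ht.2⟩)
    · rw [← mul_zero C]
      refine Tendsto.const_mul C ((tendsto_rpow_neg_atTop hβ).comp ?_)
      refine tendsto_atTop_mono (f := fun u => |u| * |t|) (fun u => ?_)
        (tendsto_abs_atTop_atTop.atTop_mul_const (abs_pos.2 ht0))
      have := Complex.abs_im_le_norm (1 + ((u * t : ℝ) : ℂ) * Complex.I)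
      simpa [abs_mul] using this

/-- If `L z = A z / z ^ β + B z` near `0`, then the Fourier integral of `Φ` against `L` on the
vertical line `re z = 1 / u`, at frequency `u`, has order `u ^ (β - 1)`: integrate by parts once
and compare `deriv L` with `-β * A 0 * z ^ (-(β + 1))`. -/
lemma tendsto_integral_of_cpow_singularity {L A B : ℂ → ℂ} {β : ℝ} (hβ : 0 < β)
    (hL : ∀ z : ℂ, 0 ≤ z.re → z ≠ 0 → AnalyticAt ℂ L z)
    (hA : AnalyticAt ℂ A 0) (hB : AnalyticAt ℂ B 0)
    (hAB : ∀ᶠ z : ℂ in 𝓝 0, 0 < z.re → L z = A z / z ^ (β : ℂ) + B z)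
    {Φ Φ' : ℝ → ℝ} {M M' R : ℝ} (hR : 0 ≤ R) (hΦ : Continuous Φ) (hΦ' : Measurable Φ')
    (hderiv : ∀ t, HasDerivWithinAt Φ (Φ' t) (Ioi t) t)
    (hM : ∀ t, |Φ t| ≤ M) (hM' : ∀ t, |Φ' t| ≤ M') (hsupp : ∀ t, R ≤ |t| → Φ t = 0) :
    Tendsto (fun u : ℝ => ((u ^ (1 - β) : ℝ) : ℂ) * ∫ t in (-R)..R,
        (Φ t : ℂ) * L (((u⁻¹ : ℝ) : ℂ) + t * Complex.I) * Complex.exp (t * u * Complex.I)) atTop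
      (𝓝 (2 * Real.pi * Complex.exp (-1) * A 0 / Complex.Gamma β * Φ 0)) := by
  obtain ⟨C, hC⟩ := exists_norm_le_of_cpow_singularity hβ hL hA hB hAB R
  let z (u t : ℝ) : ℂ := ((u⁻¹ : ℝ) : ℂ) + t * Complex.I
  have hzre (u t : ℝ) : (z u t).re = u⁻¹ := by simp [z]
  have hzim (u t : ℝ) : (z u t).im = t := by simp [z]
  have hzc (u : ℝ) : Continuous (z u) := by fun_prop
  have han {u : ℝ} (hu : 0 < u) (t : ℝ) : AnalyticAt ℂ L (z u t) := by
    refine hL _ (by rw [hzre]; positivity) fun h => ?_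
    have := hzre u t
    rw [h] at this
    simp at this
    exact hu.ne this
  have hLc {u : ℝ} (hu : 0 < u) : Continuous (fun t => L (z u t)) :=
    continuous_iff_continuousAt.2 fun t =>
      (han hu t).continuousAt.comp (f := z u) (hzc u).continuousAt
  have hLc' {u : ℝ} (hu : 0 < u) : Continuous (fun t => deriv L (z u t)) :=
    continuous_iff_continuousAt.2 fun t =>
      (han hu t).deriv.continuousAt.comp (f := z u) (hzc u).continuousAt
  have hpc {u : ℝ} (hu : 0 < u) : Continuous (fun t => z u t ^ (-((β : ℂ) + 1))) :=
    (hzc u).cpow continuous_const fun t => Or.inl (by rw [hzre]; positivity)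
  let e (u t : ℝ) : ℂ := Complex.exp (t * u * Complex.I)
  have hec (u : ℝ) : Continuous (e u) := by fun_prop
  have hen (u t : ℝ) : ‖e u t‖ = 1 := by
    simp only [e]
    rw [← Complex.ofReal_mul, Complex.norm_exp_ofReal_mul_I]
  let E (u t : ℝ) : ℂ := ((Φ' t : ℂ) * L (z u t) + Φ t * Complex.I *
    (deriv L (z u t) + β * A 0 * z u t ^ (-((β : ℂ) + 1)))) * e u t
  have hEm {u : ℝ} (hu : 0 < u) : StronglyMeasurable (E u) := by
    have h1 : Measurable (fun t => (Φ' t : ℂ)) := Complex.measurable_ofReal.comp hΦ'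
    have h2 := (hLc hu).measurable
    have h3 : Measurable (fun t => (Φ t : ℂ) * Complex.I *
      (deriv L (z u t) + β * A 0 * z u t ^ (-((β : ℂ) + 1)))) := by
      have := hLc' hu
      have := hpc hu
      exact Continuous.measurable (by fun_prop)
    exact (((h1.mul h2).add h3).mul (hec u).measurable).stronglyMeasurable
  have hM0 : 0 ≤ M := (abs_nonneg _).trans (hM 0)
  have hM0' : 0 ≤ M' := (abs_nonneg _).trans (hM' 0)
  have hEb : ∀ u, 1 ≤ u → ∀ t, |t| ≤ R → ‖E u t‖ ≤ ((M' + M) * C) * ‖z u t‖ ^ (-β) := by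
    intro u hu t ht
    have hu0 : 0 < u := by linarith
    obtain ⟨h1, h2⟩ := hC (z u t) (by rw [hzre]; positivity)
      (by rw [hzre]; exact inv_le_one_of_one_le₀ hu) (by rwa [hzim])
    simp only [E]
    rw [norm_mul, hen, mul_one]
    refine (norm_add_le _ _).trans ?_
    rw [norm_mul, norm_mul, norm_mul, Complex.norm_I, Complex.norm_real, Complex.norm_real,
      mul_one, show (M' + M) * C * ‖z u t‖ ^ (-β) =
        M' * (C * ‖z u t‖ ^ (-β)) + M * (C * ‖z u t‖ ^ (-β)) by ring]
    exact add_le_add (mul_le_mul (hM' t) h1 (norm_nonneg _) hM0')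
      (mul_le_mul (hM t) h2 (norm_nonneg _) hM0)
  have hmain := tendsto_integral_cpow_main hβ hΦ hM hsupp
  have herr := tendsto_integral_cpow_error hβ hR
    (fun u hu => (hEm (u := u) (by linarith)).aestronglyMeasurable) hEb
  have hlim := (herr.const_mul Complex.I).add (hmain.const_mul (β * A 0))
  have hval : Complex.I * 0 + β * A 0 * (Φ 0 * ∫ t : ℝ, (1 + t * Complex.I : ℂ) ^ (-((β : ℂ) + 1)) *
        Complex.exp (t * Complex.I)) =
      2 * Real.pi * Complex.exp (-1) * A 0 / Complex.Gamma β * Φ 0 := by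
    have hβ0 : (β : ℂ) ≠ 0 := by exact_mod_cast hβ.ne'
    have hG : Complex.Gamma β ≠ 0 := Complex.Gamma_ne_zero_of_re_pos (by simpa using hβ)
    rw [integral_one_add_mul_I_cpow_mul_cexp hβ, Complex.Gamma_add_one _ hβ0]
    field_simp
    ring
  rw [hval] at hlim
  refine hlim.congr' ?_
  filter_upwards [eventually_ge_atTop 1] with u hu
  have hu0 : 0 < u := by linarith
  have huC : (u : ℂ) ≠ 0 := by exact_mod_cast hu0.ne'
  have hΦR : Φ R = 0 := hsupp R (le_abs_self R)
  have hΦR' : Φ (-R) = 0 := hsupp (-R) (by rw [abs_neg]; exact le_abs_self R)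
  have hzd (t : ℝ) : HasDerivAt (z u) Complex.I t := by
    have := ((Complex.ofRealCLM.hasDerivAt (x := t)).mul_const Complex.I).const_add
      ((u⁻¹ : ℝ) : ℂ)
    rwa [Complex.ofRealCLM_apply, Complex.ofReal_one, one_mul] at this
  have hU'int : IntervalIntegrable
      (fun t => (Φ' t : ℂ) * L (z u t) + Φ t * (deriv L (z u t) * Complex.I)) volume (-R) R := by
    refine IntervalIntegrable.add (IntervalIntegrable.mul_continuousOn ?_ (hLc hu0).continuousOn) ?_
    · refine IntervalIntegrable.mono_fun' (g := fun _ => M') (by simp) ?_ ?_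
      · exact (Complex.measurable_ofReal.comp hΦ').aestronglyMeasurable
      · exact ae_of_all _ fun t => by simpa using hM' t
    · have := hLc' hu0
      exact Continuous.intervalIntegrable (by fun_prop) _ _
  have hibp := intervalIntegral.integral_mul_deriv_eq_deriv_mul_of_hasDeriv_right
    (a := -R) (b := R) (u := fun t => (Φ t : ℂ) * L (z u t))
    (u' := fun t => (Φ' t : ℂ) * L (z u t) + Φ t * (deriv L (z u t) * Complex.I))
    (v := fun t => e u t / (u * Complex.I)) (v' := e u)
    ((Complex.continuous_ofReal.comp hΦ).mul (hLc hu0)).continuousOn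
    (Continuous.continuousOn (by fun_prop))
    (fun t _ => by
      have h1 : HasDerivWithinAt (fun t => (Φ t : ℂ)) (Φ' t : ℂ) (Ioi t) t :=
        (hderiv t).ofReal_comp
      have h2 : HasDerivAt (fun t => L (z u t)) (deriv L (z u t) * Complex.I) t :=
        (han hu0 t).differentiableAt.hasDerivAt.comp t (hzd t)
      exact h1.mul h2.hasDerivWithinAt)
    (fun t _ => by
      have h1 : HasDerivAt (fun t : ℝ => (t : ℂ) * u * Complex.I) (u * Complex.I) t := by
        simpa using ((Complex.ofRealCLM.hasDerivAt (x := t)).mul_const (u : ℂ)).mul_const Complex.I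
      have h2 := h1.cexp.div_const (u * Complex.I)
      rw [mul_div_cancel_right₀ _ (mul_ne_zero huC Complex.I_ne_zero)] at h2
      exact h2.hasDerivWithinAt)
    hU'int ((hec u).intervalIntegrable _ _)
  simp only [hΦR, hΦR', Complex.ofReal_zero, zero_mul, sub_zero, zero_sub] at hibp
  change _ = _ * ∫ t in (-R)..R, (Φ t : ℂ) * L (z u t) * e u t
  rw [hibp, ← intervalIntegral.integral_const_mul, ← intervalIntegral.integral_const_mul,
    ← intervalIntegral.integral_const_mul, ← intervalIntegral.integral_const_mul,
    ← intervalIntegral.integral_neg, ← intervalIntegral.integral_const_mul,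
    ← intervalIntegral.integral_add]
  · refine intervalIntegral.integral_congr fun t _ => ?_
    simp only [E]
    have hpow : u ^ (1 - β) = u * u ^ (-β) := by
      rw [sub_eq_add_neg, Real.rpow_add hu0, Real.rpow_one]
    rw [hpow]
    change _ + _ * (_ * (_ * z u t ^ _ * e u t)) = _
    push_cast
    field_simp
    ring_nf
    simp only [Complex.I_pow_three, Complex.I_sq]
    ring
  · refine IntervalIntegrable.const_mul (IntervalIntegrable.const_mul ?_ _) _
    have h3 : E u = fun t => ((Φ' t : ℂ) * L (z u t) + Φ t * (deriv L (z u t) * Complex.I)) * e u t +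
        Φ t * Complex.I * (β * A 0 * z u t ^ (-((β : ℂ) + 1))) * e u t := by
      ext t; simp only [E]; ring
    rw [h3]
    refine (hU'int.mul_continuousOn (hec u).continuousOn).add ?_
    have := hpc hu0
    exact Continuous.intervalIntegrable (by fun_prop) _ _
  · refine IntervalIntegrable.const_mul (IntervalIntegrable.const_mul ?_ _) _
    have := hpc hu0
    have h4 : Continuous fun t => (Φ t : ℂ) * z u t ^ (-((β : ℂ) + 1)) * e u t := by fun_prop
    exact h4.intervalIntegrable _ _

lemma hasDerivAt_sq_max_zero (x : ℝ) :
    HasDerivAt (fun x : ℝ => (max 0 x) ^ 2) (2 * max 0 x) x := by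
  rcases lt_trichotomy x 0 with hx | rfl | hx
  · rw [max_eq_left hx.le, mul_zero]
    refine (hasDerivAt_const x (0 : ℝ)).congr_of_eventuallyEq ?_
    filter_upwards [gt_mem_nhds hx] with y hy
    simp [max_eq_left hy.le]
  · rw [max_self, mul_zero, hasDerivAt_iff_isLittleO]
    have h : (fun x : ℝ => x ^ 2) =o[𝓝 0] fun x => x := by
      simpa using Asymptotics.isLittleO_pow_pow (𝕜 := ℝ) (m := 1) (n := 2) (by norm_num)
    refine (Asymptotics.IsBigO.of_bound 1 (Eventually.of_forall fun x => ?_)).trans_isLittleO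
      (by simpa using h)
    simp only [max_self, smul_zero, sub_zero, one_mul, norm_pow]
    rw [zero_pow two_ne_zero, sub_zero, norm_pow]
    refine pow_le_pow_left₀ (norm_nonneg _) ?_ 2
    rw [Real.norm_eq_abs, Real.norm_eq_abs, abs_of_nonneg (le_max_left _ _)]
    exact max_le (abs_nonneg x) (le_abs_self x)
  · rw [max_eq_right hx.le]
    refine (by simpa using hasDerivAt_pow 2 x : HasDerivAt (fun x : ℝ => x ^ 2) (2 * x) x)
      |>.congr_of_eventuallyEq ?_
    filter_upwards [lt_mem_nhds hx] with y hy
    simp [max_eq_right hy.le]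

lemma hasDerivWithinAt_sqTent (t : ℝ) :
    HasDerivWithinAt sqTent (2 * max 0 (1 - |t|) * if 0 ≤ t then -1 else 1) (Ioi t) t := by
  split_ifs with ht
  · have h1 : HasDerivAt (fun t : ℝ => 1 - t) (-1) t := by
      simpa using (hasDerivAt_id t).const_sub 1
    rw [abs_of_nonneg ht]
    refine (((hasDerivAt_sq_max_zero (1 - t)).comp t h1).hasDerivWithinAt).congr
      (fun s hs => ?_) ?_
    · simp [sqTent, abs_of_nonneg (ht.trans (le_of_lt hs))]
    · simp [sqTent, abs_of_nonneg ht]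
  · have h1 : HasDerivAt (fun t : ℝ => 1 + t) 1 t := by
      simpa using (hasDerivAt_id t).const_add 1
    rw [not_le] at ht
    rw [abs_of_neg ht, sub_neg_eq_add]
    refine (((hasDerivAt_sq_max_zero (1 + t)).comp t h1).congr_of_eventuallyEq ?_).hasDerivWithinAt
    filter_upwards [gt_mem_nhds ht] with s hs
    simp [sqTent, abs_of_neg hs]

lemma abs_sqTent_le_one (t : ℝ) : |sqTent t| ≤ 1 := by
  have h : max 0 (1 - |t|) ≤ 1 := max_le zero_le_one (by linarith [abs_nonneg t])
  rw [sqTent, abs_of_nonneg (by positivity)]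
  exact pow_le_one₀ (le_max_left _ _) h

lemma tendsto_integral_sqTent_of_cpow_singularity {F A B : ℂ → ℂ} {ρ β : ℝ} (hβ : 0 < β)
    (hF : ∀ s : ℂ, ρ ≤ s.re → s ≠ (ρ : ℂ) → AnalyticAt ℂ F s)
    (hA : AnalyticAt ℂ A (ρ : ℂ)) (hB : AnalyticAt ℂ B (ρ : ℂ))
    (hAB : ∀ᶠ s : ℂ in 𝓝 (ρ : ℂ), ρ < s.re → F s = A s / (s - (ρ : ℂ)) ^ (β : ℂ) + B s)
    (l : ℝ) :
    Tendsto (fun u : ℝ => ((u ^ (1 - β) : ℝ) : ℂ) * ∫ t : ℝ,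
        (sqTent (t + l) : ℂ) * F (((ρ + u⁻¹ : ℝ) : ℂ) + t * Complex.I) *
          Complex.exp (t * u * Complex.I)) atTop
      (𝓝 (2 * Real.pi * Complex.exp (-1) * A ρ / Complex.Gamma β * sqTent l)) := by
  have hadd {f : ℂ → ℂ} {z : ℂ} (hf : AnalyticAt ℂ f (ρ + z)) :
      AnalyticAt ℂ (fun z => f (ρ + z)) z :=
    hf.comp_of_eq (g := f) (f := fun z => (ρ : ℂ) + z) (by fun_prop) rfl
  have hsupp (t : ℝ) (ht : 1 + |l| ≤ |t|) : sqTent (t + l) = 0 := by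
    refine sqTent_eq_zero ?_
    have := abs_sub_abs_le_abs_sub t (-l)
    rw [abs_neg, sub_neg_eq_add] at this
    linarith
  have key := tendsto_integral_of_cpow_singularity hβ
    (L := fun z => F (ρ + z)) (A := fun z => A (ρ + z)) (B := fun z => B (ρ + z))
    (fun z hz hz0 => hadd (hF _ (by simpa using hz) (by simpa using hz0)))
    (hadd (by simpa using hA)) (hadd (by simpa using hB))
    (by
      have h : Tendsto (fun z : ℂ => (ρ : ℂ) + z) (𝓝 0) (𝓝 ρ) := by
        simpa using (continuous_const_add (ρ : ℂ)).tendsto 0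
      filter_upwards [h.eventually hAB] with z hz hz0
      simpa using hz (by simpa using hz0))
    (Φ := fun t => sqTent (t + l))
    (Φ' := fun t => 2 * max 0 (1 - |t + l|) * if 0 ≤ t + l then -1 else 1)
    (M := 1) (M' := 2) (R := 1 + |l|) (by positivity)
    (continuous_sqTent.comp (continuous_add_const l))
    (by
      refine Measurable.mul (Continuous.measurable (by fun_prop)) ?_
      exact Measurable.ite (measurableSet_le measurable_const (by fun_prop)) measurable_const
        measurable_const)
    (fun t => by
      have h := (hasDerivWithinAt_sqTent (t + l)).comp t (h := fun t => t + l)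
        (((hasDerivAt_id t).add_const l).hasDerivWithinAt (s := Ioi t))
        (fun s hs => by simpa using hs)
      rw [mul_one] at h
      exact h)
    (fun t => abs_sqTent_le_one _)
    (fun t => by
      have h : max 0 (1 - |t + l|) ≤ 1 := max_le zero_le_one (by linarith [abs_nonneg (t + l)])
      have h0 := le_max_left 0 (1 - |t + l|)
      rw [abs_mul, abs_mul, abs_of_nonneg h0, abs_two]
      split_ifs <;> simp [h])
    hsupp
  simp only [zero_add, add_zero] at key
  refine key.congr fun u => ?_
  congr 1
  rw [intervalIntegral.integral_eq_integral_of_support_subset]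
  · congr 1; ext t
    push_cast
    rw [add_assoc]
  · intro t ht
    have h2 : ¬ 1 + |l| ≤ |t| := fun h => ht (by simp [hsupp t h])
    have := abs_lt.1 (not_le.1 h2)
    exact ⟨this.1, this.2.le⟩

lemma hasSum_integral_sqTent_mul_dirichlet {a : ℕ → ℝ} {G : ℂ → ℂ} {σ : ℝ} (hσ : 0 < σ)
    (hG : ∀ t : ℝ, HasSum (fun N : ℕ => (a N : ℂ) * (N : ℂ) ^ (-((σ : ℂ) + t * Complex.I)))
      (G ((σ : ℂ) + t * Complex.I))) (u l : ℝ) :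
    HasSum (fun N : ℕ => ((a N * (N : ℝ) ^ (-σ) * sqTentFourier (Real.log N - u) : ℝ) : ℂ) *
        Complex.exp (l * (Real.log N - u : ℝ) * Complex.I))
      (∫ t : ℝ, (sqTent (t + l) : ℂ) * G ((σ : ℂ) + t * Complex.I) *
        Complex.exp (t * u * Complex.I)) := by
  let f (N : ℕ) (t : ℝ) : ℂ := (sqTent (t + l) : ℂ) *
    ((a N : ℂ) * (N : ℂ) ^ (-((σ : ℂ) + t * Complex.I))) * Complex.exp (t * u * Complex.I)
  have htent : Integrable (fun t => (sqTent (t + l) : ℂ)) :=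
    ((continuous_sqTent.integrable_of_hasCompactSupport hasCompactSupport_sqTent).ofReal
      (𝕜 := ℂ)).comp_add_right l
  have hpow {N : ℕ} (hN : N ≠ 0) (t : ℝ) : (N : ℂ) ^ (-((σ : ℂ) + t * Complex.I)) =
      ((N : ℝ) ^ (-σ) : ℝ) * Complex.exp (-(t * Real.log N * Complex.I)) := by
    have hN' : (N : ℂ) ≠ 0 := by exact_mod_cast hN
    rw [neg_add, Complex.cpow_add _ _ hN', Complex.ofReal_cpow (by positivity),
      Complex.cpow_def_of_ne_zero hN' (-(t * Complex.I)), ← Complex.ofReal_natCast,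
      ← Complex.ofReal_log (by positivity)]
    push_cast
    congr 2
    ring
  have hf (N : ℕ) (t : ℝ) : f N t = ((a N * (N : ℝ) ^ (-σ) : ℝ) : ℂ) *
      ((sqTent (t + l) : ℂ) * Complex.exp ((-(Real.log N - u) : ℝ) * t * Complex.I)) := by
    rcases eq_or_ne N 0 with rfl | hN
    · have h0 : -((σ : ℂ) + t * Complex.I) ≠ 0 := fun h => by
        have := congrArg Complex.re h
        simp at this
        exact hσ.ne' this
      simp only [f, Nat.cast_zero, Complex.zero_cpow h0, Real.zero_rpow (neg_ne_zero.2 hσ.ne')]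
      simp
    · simp only [f]
      rw [hpow hN, show ((-(Real.log N - u) : ℝ) : ℂ) * t * Complex.I =
        -(t * Real.log N * Complex.I) + t * u * Complex.I by push_cast; ring, Complex.exp_add]
      push_cast
      ring
  have hnorm (N : ℕ) (t : ℝ) : ‖f N t‖ = ‖a N * (N : ℝ) ^ (-σ)‖ * ‖(sqTent (t + l) : ℂ)‖ := by
    rw [hf, norm_mul, norm_mul, ← Complex.ofReal_mul, Complex.norm_exp_ofReal_mul_I, mul_one,
      Complex.norm_real]
  have hint (N : ℕ) : Integrable (f N) := by
    refine (htent.norm.const_mul ‖a N * (N : ℝ) ^ (-σ)‖).mono' ?_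
      (ae_of_all _ fun t => (hnorm N t).le)
    rw [funext (hf N)]
    exact Continuous.aestronglyMeasurable (by have := continuous_sqTent; fun_prop)
  have hsum : Summable fun N : ℕ => ‖a N * (N : ℝ) ^ (-σ)‖ := by
    refine (hG 0).summable.norm.congr fun N => ?_
    rw [← Complex.norm_real]
    push_cast
    rw [Complex.ofReal_cpow (by positivity)]
    simp
  have key := hasSum_integral_of_summable_integral_norm hint (by
    simp_rw [hnorm, integral_const_mul]
    exact hsum.mul_right _)
  have hterm (N : ℕ) : ∫ t, f N t =
      ((a N * (N : ℝ) ^ (-σ) * sqTentFourier (Real.log N - u) : ℝ) : ℂ) *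
        Complex.exp (l * (Real.log N - u : ℝ) * Complex.I) := by
    simp_rw [hf]
    rw [integral_const_mul]
    set w := Real.log N - u
    have h := integral_add_right_eq_self (μ := volume) (fun t : ℝ => (sqTent t : ℂ) *
      Complex.exp ((-w : ℝ) * t * Complex.I) * Complex.exp (l * w * Complex.I)) l
    rw [integral_mul_const (Complex.exp (l * w * Complex.I)) fun t : ℝ => (sqTent t : ℂ) *
      Complex.exp ((-w : ℝ) * t * Complex.I), integral_sqTent_mul_cexp, sqTentFourier_neg] at h
    rw [Complex.ofReal_mul (a N * _), mul_assoc, ← h]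
    congr 2; ext t
    rw [mul_assoc (sqTent (t + l) : ℂ), ← Complex.exp_add]
    congr 2
    push_cast
    ring
  simp_rw [hterm] at key
  have htsum (t : ℝ) : (sqTent (t + l) : ℂ) * G ((σ : ℂ) + t * Complex.I) *
      Complex.exp (t * u * Complex.I) = ∑' N, f N t :=
    (((hG t).mul_left _).mul_right _).tsum_eq.symm
  simp_rw [htsum]
  exact key

/-- The point masses at `log N - u`, weighted by the terms of the Dirichlet series at `ρ + 1 / u`
and the kernel `sqTentFourier`, converge weakly to a multiple of `sqTentFourier` as `u → ∞`. -/
lemma tendsto_tsum_of_cpow_singularity {a : ℕ → ℝ} {ρ β : ℝ} (hρ : 0 < ρ) (hβ : 0 < β)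
    {F A B : ℂ → ℂ} (ha : ∀ N, 0 ≤ a N)
    (hsum : ∀ s : ℂ, ρ < s.re → HasSum (fun N : ℕ => (a N : ℂ) * (N : ℂ) ^ (-s)) (F s))
    (hF : ∀ s : ℂ, ρ ≤ s.re → s ≠ (ρ : ℂ) → AnalyticAt ℂ F s)
    (hA : AnalyticAt ℂ A (ρ : ℂ)) (hB : AnalyticAt ℂ B (ρ : ℂ))
    (hAB : ∀ᶠ s : ℂ in 𝓝 (ρ : ℂ), ρ < s.re → F s = A s / (s - (ρ : ℂ)) ^ (β : ℂ) + B s) :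
    ∃ c : ℝ, 0 ≤ c ∧ A ρ = ((c * Real.Gamma β : ℝ) : ℂ) ∧
      ∀ f : BoundedContinuousFunction ℝ ℝ,
        (∀ u : ℝ, 1 ≤ u → Summable fun N : ℕ => u ^ (1 - β) * (a N * (N : ℝ) ^ (-(ρ + u⁻¹)) *
          sqTentFourier (Real.log N - u)) * f (Real.log N - u)) ∧
        Tendsto (fun u : ℝ => ∑' N : ℕ, u ^ (1 - β) * (a N * (N : ℝ) ^ (-(ρ + u⁻¹)) *
          sqTentFourier (Real.log N - u)) * f (Real.log N - u)) atTop
          (𝓝 (Real.exp (-1) * c * ∫ w, sqTentFourier w * f w)) := by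
  let b (u : ℝ) (N : ℕ) : ℝ := u ^ (1 - β) * (a N * (N : ℝ) ^ (-(ρ + u⁻¹)) *
    sqTentFourier (Real.log N - u))
  have hb0 {u : ℝ} (hu : 1 ≤ u) (N : ℕ) : 0 ≤ b u N :=
    mul_nonneg (by positivity) (mul_nonneg (mul_nonneg (ha N) (by positivity))
      (sqTentFourier_pos _).le)
  have hchar {u : ℝ} (hu : 1 ≤ u) (l : ℝ) : HasSum
      (fun N => (b u N : ℂ) * Complex.exp (l * (Real.log N - u : ℝ) * Complex.I))
      (((u ^ (1 - β) : ℝ) : ℂ) * ∫ t : ℝ, (sqTent (t + l) : ℂ) *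
        F (((ρ + u⁻¹ : ℝ) : ℂ) + t * Complex.I) * Complex.exp (t * u * Complex.I)) := by
    have hu0 : 0 < u := by linarith
    have hσ : ρ < ρ + u⁻¹ := by simpa
    have h := (hasSum_integral_sqTent_mul_dirichlet (hρ.trans hσ)
      (fun t => hsum _ (by simpa using hσ)) u l).mul_left ((u ^ (1 - β) : ℝ) : ℂ)
    refine h.congr_fun fun N => ?_
    simp only [b]
    push_cast
    ring
  have hbs {u : ℝ} (hu : 1 ≤ u) : Summable (b u) := by
    refine (hchar hu 0).summable.norm.congr fun N => ?_
    simp [abs_of_nonneg (hb0 hu N)]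
  let P (u : ℝ) : Measure ℝ := Measure.sum fun N : ℕ =>
    ENNReal.ofReal (b u N) • Measure.dirac (Real.log N - u)
  have hPint {E : Type} [NormedAddCommGroup E] [NormedSpace ℝ E] [CompleteSpace E]
      {u : ℝ} (hu : 1 ≤ u) {f : ℝ → E} {M : ℝ} (hM : ∀ x, ‖f x‖ ≤ M) :
      HasSum (fun N : ℕ => b u N • f (Real.log N - u)) (∫ x, f x ∂(P u)) := by
    have h := hasSum_integral_sum_dirac (c := fun N => ENNReal.ofReal (b u N)) (f := f)
      (x := fun N : ℕ => Real.log N - u) (fun _ => ENNReal.ofReal_ne_top) (by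
        simp_rw [ENNReal.toReal_ofReal (hb0 hu _)]
        exact ((hbs hu).mul_right M).of_nonneg_of_le
          (fun N => mul_nonneg (hb0 hu N) (norm_nonneg _))
          (fun N => mul_le_mul_of_nonneg_left (hM _) (hb0 hu N)))
    simpa only [ENNReal.toReal_ofReal (hb0 hu _)] using h
  have hfin {u : ℝ} (hu : 1 ≤ u) : IsFiniteMeasure (P u) := by
    refine ⟨?_⟩
    simp only [P, Measure.sum_apply _ MeasurableSet.univ, Measure.smul_apply, smul_eq_mul,
      measure_univ, mul_one]
    rw [← ENNReal.ofReal_tsum_of_nonneg (hb0 hu) (hbs hu)]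
    exact ENNReal.ofReal_lt_top
  have hPchar {u : ℝ} (hu : 1 ≤ u) (l : ℝ) : charFun (P u) l = ((u ^ (1 - β) : ℝ) : ℂ) *
      ∫ t : ℝ, (sqTent (t + l) : ℂ) *
        F (((ρ + u⁻¹ : ℝ) : ℂ) + t * Complex.I) * Complex.exp (t * u * Complex.I) := by
    rw [charFun_apply_real]
    refine HasSum.unique (hPint hu (M := 1) fun x => ?_) ?_
    · rw [← Complex.ofReal_mul, Complex.norm_exp_ofReal_mul_I]
    · simpa only [Complex.real_smul] using hchar hu l
  have hlim (l : ℝ) : Tendsto (fun u => charFun (P u) l) atTop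
      (𝓝 (2 * Real.pi * Complex.exp (-1) * A ρ / Complex.Gamma β * sqTent l)) :=
    (tendsto_integral_sqTent_of_cpow_singularity hβ hF hA hB hAB l).congr' <| by
      filter_upwards [eventually_ge_atTop 1] with u hu using (hPchar hu l).symm
  obtain ⟨c, hc0, hc⟩ : ∃ c : ℝ, 0 ≤ c ∧ A ρ = ((c * Real.Gamma β : ℝ) : ℂ) := by
    have hG : Complex.Gamma β ≠ 0 := Complex.Gamma_ne_zero_of_re_pos (by simpa using hβ)
    have h0 : Tendsto (fun u => ((∑' N, b u N : ℝ) : ℂ)) atTop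
        (𝓝 (2 * Real.pi * Complex.exp (-1) * A ρ / Complex.Gamma β)) := by
      have := hlim 0
      rw [show sqTent 0 = 1 by simp [sqTent], Complex.ofReal_one, mul_one] at this
      refine this.congr' ?_
      filter_upwards [eventually_ge_atTop 1] with u hu
      rw [hPchar hu, ← (hchar hu 0).tsum_eq, Complex.ofReal_tsum]
      simp
    set m := 2 * Real.pi * Complex.exp (-1) * A ρ / Complex.Gamma β with hm
    have hre : 0 ≤ m.re := by
      refine ge_of_tendsto ((Complex.continuous_re.tendsto _).comp h0) ?_
      filter_upwards [eventually_ge_atTop 1] with u hu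
      rw [Function.comp_apply, Complex.ofReal_re]
      exact tsum_nonneg (hb0 hu)
    have him : m.im = 0 := by
      refine tendsto_nhds_unique ((Complex.continuous_im.tendsto _).comp h0) ?_
      simp [Function.comp_def]
    refine ⟨m.re / (2 * Real.pi * Real.exp (-1)), by positivity, ?_⟩
    have hmr : m = (m.re : ℂ) := Complex.ext rfl (by simpa using him)
    have hA' : A ρ = m * Complex.Gamma β / (2 * Real.pi * Complex.exp (-1)) := by
      rw [hm]
      have := Complex.exp_ne_zero (-1)
      have : (Real.pi : ℂ) ≠ 0 := by exact_mod_cast Real.pi_ne_zero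
      field_simp
    rw [hA', hmr, Complex.Gamma_ofReal]
    push_cast
    simp only [Complex.ofReal_re]
    ring
  refine ⟨c, hc0, hc, fun f => ⟨fun u hu => (hPint hu f.norm_coe_le_norm).summable, ?_⟩⟩
  have hk0 : 0 ≤ Real.exp (-1) * c := by positivity
  let k (w : ℝ) : ℝ := Real.exp (-1) * c * sqTentFourier w
  have hkm : Measurable k := (continuous_const.mul continuous_sqTentFourier).measurable
  have hkn (w : ℝ) : 0 ≤ k w := mul_nonneg hk0 (sqTentFourier_pos w).le
  let Q : Measure ℝ := volume.withDensity fun w => ENNReal.ofReal (k w)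
  have hki : Integrable k := integrable_sqTentFourier.const_mul _
  have : IsFiniteMeasure Q := isFiniteMeasure_withDensity_ofReal hki.2
  have hQint {E : Type} [NormedAddCommGroup E] [NormedSpace ℝ E] (g : ℝ → E) :
      ∫ w, g w ∂Q = ∫ w, k w • g w := by
    rw [integral_withDensity_eq_integral_toReal_smul hkm.ennreal_ofReal
      (ae_of_all _ fun _ => ENNReal.ofReal_lt_top)]
    simp_rw [ENNReal.toReal_ofReal (hkn _)]
  have hQchar (l : ℝ) : charFun Q l =
      2 * Real.pi * Complex.exp (-1) * A ρ / Complex.Gamma β * sqTent l := by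
    rw [charFun_apply_real, hQint]
    simp only [k, Complex.real_smul, Complex.ofReal_mul, mul_assoc]
    have hG : (Real.Gamma β : ℂ) ≠ 0 := by exact_mod_cast (Real.Gamma_pos_of_pos hβ).ne'
    have h := integral_sqTentFourier_mul_cexp l
    simp only [mul_assoc] at h
    rw [integral_const_mul, integral_const_mul, h, hc, Complex.Gamma_ofReal]
    push_cast
    field_simp
  have hfin' (u : ℝ) : IsFiniteMeasure (P (max u 1)) := hfin (le_max_right u 1)
  have hmax : ∀ᶠ u : ℝ in atTop, max u 1 = u := by
    filter_upwards [eventually_ge_atTop 1] with u hu using max_eq_left hu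
  have key := tendsto_integral_of_tendsto_charFun (P := fun u => P (max u 1)) (Q := Q) (l := atTop)
    (fun l => by
      rw [hQchar]
      refine (hlim l).congr' ?_
      filter_upwards [hmax] with u hu
      rw [hu]) f
  rw [hQint] at key
  have hval : ∫ w, k w • f w = Real.exp (-1) * c * ∫ w, sqTentFourier w * f w := by
    rw [← integral_const_mul]
    congr 1; ext w
    simp only [k, smul_eq_mul, mul_assoc]
  rw [hval] at key
  refine key.congr' ?_
  filter_upwards [eventually_ge_atTop 1, hmax] with u hu hu'
  rw [hu', ← (hPint hu f.norm_coe_le_norm).tsum_eq]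
  rfl

/-- Bounded continuous test functions approximating `exp (η * w) / sqTentFourier w` on a
half-line. -/
lemma exists_boundedContinuousFunction_sqTentFourier_mul {η p q : ℝ} (hη : 0 < η) (hpq : p < q) :
    ∃ f : BoundedContinuousFunction ℝ ℝ, (∀ w, 0 ≤ f w) ∧
      (∀ w, w ≤ p → sqTentFourier w * f w = Real.exp (η * w)) ∧
      (∀ w, q ≤ w → f w = 0) ∧
      (∀ w, sqTentFourier w * f w ≤ Real.exp (η * w)) ∧
      Real.exp (η * p) / η ≤ ∫ w, sqTentFourier w * f w ∧
      ∫ w, sqTentFourier w * f w ≤ Real.exp (η * q) / η := by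
  obtain ⟨κ, hκ, C, hC, hK⟩ := exists_bounds_sqTentFourier
  have hqp : 0 < q - p := sub_pos.2 hpq
  let T (w : ℝ) : ℝ := max 0 (min 1 ((q - w) / (q - p)))
  have hTc : Continuous T := by fun_prop
  have hT0 (w : ℝ) : 0 ≤ T w := le_max_left _ _
  have hT1 (w : ℝ) : T w ≤ 1 := max_le zero_le_one (min_le_left _ _)
  have hTp {w : ℝ} (hw : w ≤ p) : T w = 1 := by
    have : 1 ≤ (q - w) / (q - p) := (one_le_div hqp).2 (by linarith)
    simp [T, min_eq_left this]
  have hTq {w : ℝ} (hw : q ≤ w) : T w = 0 := by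
    have : (q - w) / (q - p) ≤ 0 := div_nonpos_of_nonpos_of_nonneg (by linarith) hqp.le
    simp [T, min_eq_right (this.trans zero_le_one), this]
  have hexp {w : ℝ} (hw : w ≤ q) :
      (1 + w ^ 2) * Real.exp (η * w) ≤ (1 + 2 / η ^ 2) + (1 + q ^ 2) * Real.exp (η * q) := by
    rcases le_total 0 w with h0 | h0
    · have h1 : (1 + w ^ 2) * Real.exp (η * w) ≤ (1 + q ^ 2) * Real.exp (η * q) := by gcongr
      have : 0 ≤ 1 + 2 / η ^ 2 := by positivity
      linarith
    · have h1 := Real.quadratic_le_exp_of_nonneg (x := η * -w)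
        (mul_nonneg hη.le (by linarith))
      have h2 : Real.exp (η * w) * Real.exp (η * -w) = 1 := by
        rw [← Real.exp_add]; simp
      have h3 : 0 < Real.exp (η * w) := Real.exp_pos _
      have h4 : Real.exp (η * w) ≤ 1 := Real.exp_le_one_iff.2 (mul_nonpos_of_nonneg_of_nonpos hη.le h0)
      have h5 : w ^ 2 * Real.exp (η * w) ≤ 2 / η ^ 2 := by
        rw [le_div_iff₀ (by positivity)]
        have h6 : (η * -w) ^ 2 / 2 ≤ Real.exp (η * -w) := by nlinarith
        nlinarith [mul_le_mul_of_nonneg_left h6 h3.le]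
      have : 0 ≤ (1 + q ^ 2) * Real.exp (η * q) := by positivity
      linarith
  let g (w : ℝ) : ℝ := Real.exp (η * w) * T w / sqTentFourier w
  have hgc : Continuous g := by
    refine Continuous.div (by fun_prop) continuous_sqTentFourier fun w => (sqTentFourier_pos w).ne'
  have hg0 (w : ℝ) : 0 ≤ g w :=
    div_nonneg (mul_nonneg (Real.exp_pos _).le (hT0 w)) (sqTentFourier_pos w).le
  have hgb (w : ℝ) : ‖g w‖ ≤ ((1 + 2 / η ^ 2) + (1 + q ^ 2) * Real.exp (η * q)) / κ := by
    rw [Real.norm_of_nonneg (hg0 w)]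
    rcases le_total q w with h | h
    · simp only [g, hTq h, mul_zero, zero_div]
      positivity
    · rw [div_le_div_iff₀ (sqTentFourier_pos w) hκ]
      have h1 : Real.exp (η * w) * T w ≤ Real.exp (η * w) :=
        mul_le_of_le_one_right (Real.exp_pos _).le (hT1 w)
      calc Real.exp (η * w) * T w * κ
          ≤ Real.exp (η * w) * ((1 + w ^ 2) * sqTentFourier w) :=
            mul_le_mul h1 (hK w).1 hκ.le (Real.exp_pos _).le
        _ = (1 + w ^ 2) * Real.exp (η * w) * sqTentFourier w := by ring
        _ ≤ _ := mul_le_mul_of_nonneg_right (hexp h) (sqTentFourier_pos w).le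
  let f : BoundedContinuousFunction ℝ ℝ := BoundedContinuousFunction.ofNormedAddCommGroup g hgc _ hgb
  have hf (w : ℝ) : sqTentFourier w * f w = Real.exp (η * w) * T w :=
    mul_div_cancel₀ _ (sqTentFourier_pos w).ne'
  have hle (w : ℝ) : Real.exp (η * w) * T w ≤ Real.exp (η * w) :=
    mul_le_of_le_one_right (Real.exp_pos _).le (hT1 w)
  have hval (x : ℝ) : ∫ w in Iic x, Real.exp (η * w) = Real.exp (η * x) / η := integral_exp_mul_Iic hη x
  have hint (x : ℝ) : IntegrableOn (fun w => Real.exp (η * w)) (Iic x) := integrableOn_exp_mul_Iic hη x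
  have hsupp : ∫ w, Real.exp (η * w) * T w = ∫ w in Iic q, Real.exp (η * w) * T w := by
    refine (setIntegral_eq_integral_of_forall_compl_eq_zero fun w hw => ?_).symm
    rw [hTq (not_le.1 hw).le, mul_zero]
  have hTi : IntegrableOn (fun w => Real.exp (η * w) * T w) (Iic q) := by
    refine (hint q).mono' (Continuous.aestronglyMeasurable (by fun_prop)) (ae_of_all _ fun w => ?_)
    rw [Real.norm_of_nonneg (mul_nonneg (Real.exp_pos _).le (hT0 w))]
    exact hle w
  refine ⟨f, hg0, fun w hw => ?_, fun w hw => ?_, fun w => ?_, ?_, ?_⟩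
  · rw [hf, hTp hw, mul_one]
  · change g w = 0
    simp [g, hTq hw]
  · rw [hf]
    exact hle w
  · simp_rw [hf]
    rw [hsupp, ← hval]
    calc ∫ w in Iic p, Real.exp (η * w) = ∫ w in Iic p, Real.exp (η * w) * T w :=
          setIntegral_congr_fun measurableSet_Iic fun w hw => by simp [hTp hw]
      _ ≤ _ := setIntegral_mono_set hTi
          (ae_of_all _ fun w => mul_nonneg (Real.exp_pos _).le (hT0 w))
          (Iic_subset_Iic.2 hpq.le).eventuallyLE
  · simp_rw [hf]
    rw [hsupp, ← hval]
    exact setIntegral_mono hTi (hint q) hle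

/-- Weak convergence of the weighted point masses yields the asymptotics of the partial sums. -/
lemma tendsto_sum_of_tendsto_tsum {a : ℕ → ℝ} {ρ β c : ℝ} (hρ : 0 < ρ) (ha : ∀ N, 0 ≤ a N)
    (hc : 0 ≤ c)
    (h : ∀ f : BoundedContinuousFunction ℝ ℝ,
        (∀ u : ℝ, 1 ≤ u → Summable fun N : ℕ => u ^ (1 - β) * (a N * (N : ℝ) ^ (-(ρ + u⁻¹)) *
          sqTentFourier (Real.log N - u)) * f (Real.log N - u)) ∧
        Tendsto (fun u : ℝ => ∑' N : ℕ, u ^ (1 - β) * (a N * (N : ℝ) ^ (-(ρ + u⁻¹)) *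
          sqTentFourier (Real.log N - u)) * f (Real.log N - u)) atTop
          (𝓝 (Real.exp (-1) * c * ∫ w, sqTentFourier w * f w))) :
    Tendsto (fun u : ℝ => u ^ (1 - β) * Real.exp (-(ρ * u)) *
      ∑ N ∈ Finset.Icc 1 ⌊Real.exp u⌋₊, a N) atTop (𝓝 (c / ρ)) := by
  let H (u : ℝ) : ℝ := u ^ (1 - β) * Real.exp (-(ρ * u)) * ∑ N ∈ Finset.Icc 1 ⌊Real.exp u⌋₊, a N
  have hlog {u : ℝ} {N : ℕ} (hN : 1 ≤ N) : N ≤ ⌊Real.exp u⌋₊ ↔ Real.log N - u ≤ 0 := by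
    rw [Nat.le_floor_iff (Real.exp_pos u).le, sub_nonpos, Real.log_le_iff_le_exp (by positivity)]
  have hpow {u : ℝ} (hu : 1 ≤ u) {N : ℕ} (hN : 1 ≤ N) : Real.exp 1 * (N : ℝ) ^ (-(ρ + u⁻¹)) =
      Real.exp (-(ρ * u)) * Real.exp (-((ρ + u⁻¹) * (Real.log N - u))) := by
    have hu0 : u ≠ 0 := by positivity
    rw [Real.rpow_def_of_pos (by positivity), ← Real.exp_add, ← Real.exp_add]
    congr 1
    field_simp
    ring
  have hupper {ε : ℝ} (hε : 0 < ε) :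
      ∀ᶠ u in atTop, H u < c * (Real.exp (ρ * ε) / ρ) + ε := by
    obtain ⟨f, hf0, hfp, -, -, -, hfi⟩ :=
      exists_boundedContinuousFunction_sqTentFourier_mul hρ hε
    obtain ⟨hs, hl⟩ := h f
    have hlim := (hl.const_mul (Real.exp 1)).eventually_lt_const
      (u := c * (Real.exp (ρ * ε) / ρ) + ε) (by
        rw [← mul_assoc, ← mul_assoc, ← Real.exp_add]
        have := mul_le_mul_of_nonneg_left hfi hc
        simp only [add_neg_cancel, Real.exp_zero, one_mul]
        linarith)
    filter_upwards [hlim, eventually_ge_atTop 1] with u hu hu1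
    refine lt_of_le_of_lt ?_ hu
    have hnn (N : ℕ) : 0 ≤ u ^ (1 - β) * (a N * (N : ℝ) ^ (-(ρ + u⁻¹)) *
        sqTentFourier (Real.log N - u)) * f (Real.log N - u) :=
      mul_nonneg (mul_nonneg (by positivity) (mul_nonneg (mul_nonneg (ha N) (by positivity))
        (sqTentFourier_pos _).le)) (hf0 _)
    refine le_trans ?_ (mul_le_mul_of_nonneg_left
      ((hs u hu1).sum_le_tsum (Finset.Icc 1 ⌊Real.exp u⌋₊) fun N _ => hnn N) (Real.exp_pos 1).le)
    simp only [H]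
    rw [Finset.mul_sum, Finset.mul_sum]
    refine Finset.sum_le_sum fun N hN => ?_
    obtain ⟨hN1, hN2⟩ := Finset.mem_Icc.1 hN
    have hw := (hlog hN1).1 hN2
    set w := Real.log N - u
    have e1 : Real.exp 1 * (u ^ (1 - β) * (a N * (N : ℝ) ^ (-(ρ + u⁻¹)) *
        sqTentFourier w) * f w) = u ^ (1 - β) * Real.exp (-(ρ * u)) * a N *
          (Real.exp (-((ρ + u⁻¹) * w)) * Real.exp (ρ * w)) := by
      rw [← hfp w hw]
      linear_combination (u ^ (1 - β) * a N * sqTentFourier w * f w) * hpow hu1 hN1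
    rw [e1, ← Real.exp_add]
    refine le_mul_of_one_le_right (mul_nonneg (by positivity) (ha N)) (Real.one_le_exp ?_)
    have : u⁻¹ * w ≤ 0 := mul_nonpos_of_nonneg_of_nonpos (by positivity) hw
    linarith
  have hlower {ε : ℝ} (hε : 0 < ε) :
      ∀ᶠ u in atTop, c * (Real.exp ((ρ + ε) * (-ε)) / (ρ + ε)) - ε < H u := by
    obtain ⟨f, -, -, hfq, hfe, hfi, -⟩ :=
      exists_boundedContinuousFunction_sqTentFourier_mul (η := ρ + ε) (by positivity)
        (neg_lt_zero.2 hε)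
    obtain ⟨hs, hl⟩ := h f
    have hlim := (hl.const_mul (Real.exp 1)).eventually_const_lt
      (u := c * (Real.exp ((ρ + ε) * (-ε)) / (ρ + ε)) - ε) (by
        rw [← mul_assoc, ← mul_assoc, ← Real.exp_add]
        have := mul_le_mul_of_nonneg_left hfi hc
        simp only [add_neg_cancel, Real.exp_zero, one_mul]
        linarith)
    filter_upwards [hlim, eventually_ge_atTop 1, eventually_ge_atTop ε⁻¹] with u hu hu1 huε
    refine lt_of_lt_of_le hu ?_
    rw [tsum_eq_sum (s := Finset.Icc 1 ⌊Real.exp u⌋₊)]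
    · simp only [H]
      rw [Finset.mul_sum, Finset.mul_sum]
      refine Finset.sum_le_sum fun N hN => ?_
      obtain ⟨hN1, hN2⟩ := Finset.mem_Icc.1 hN
      have hw := (hlog hN1).1 hN2
      set w := Real.log N - u
      have hX : 0 ≤ u ^ (1 - β) * Real.exp (-(ρ * u)) * a N := mul_nonneg (by positivity) (ha N)
      calc Real.exp 1 * (u ^ (1 - β) * (a N * (N : ℝ) ^ (-(ρ + u⁻¹)) * sqTentFourier w) * f w)
          = u ^ (1 - β) * Real.exp (-(ρ * u)) * a N *
            (Real.exp (-((ρ + u⁻¹) * w)) * (sqTentFourier w * f w)) := by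
            linear_combination (u ^ (1 - β) * a N * sqTentFourier w * f w) * hpow hu1 hN1
        _ ≤ u ^ (1 - β) * Real.exp (-(ρ * u)) * a N *
            (Real.exp (-((ρ + u⁻¹) * w)) * Real.exp ((ρ + ε) * w)) := by
            gcongr
            exact hfe w
        _ ≤ u ^ (1 - β) * Real.exp (-(ρ * u)) * a N := by
            rw [← Real.exp_add]
            refine mul_le_of_le_one_right hX (Real.exp_le_one_iff.2 ?_)
            have h1 : u⁻¹ ≤ ε := inv_le_of_inv_le₀ hε huε
            have h2 : (ε - u⁻¹) * w ≤ 0 := mul_nonpos_of_nonneg_of_nonpos (by linarith) hw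
            linarith
    · intro N hN
      rcases Nat.eq_zero_or_pos N with rfl | hN1
      · have : -(ρ + u⁻¹) ≠ 0 := by
          have : 0 < ρ + u⁻¹ := by positivity
          linarith
        rw [Nat.cast_zero, Real.zero_rpow this]
        simp
      · rw [hfq, mul_zero]
        by_contra hcon
        exact hN (Finset.mem_Icc.2 ⟨hN1, (hlog hN1).2 (not_le.1 hcon).le⟩)
  have hcU : Tendsto (fun ε : ℝ => c * (Real.exp (ρ * ε) / ρ) + ε) (𝓝[>] 0) (𝓝 (c / ρ)) := by
    have : Continuous fun ε : ℝ => c * (Real.exp (ρ * ε) / ρ) + ε := by fun_prop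
    refine (this.tendsto' 0 _ ?_).mono_left nhdsWithin_le_nhds
    simp [div_eq_mul_inv]
  have hcL : Tendsto (fun ε : ℝ => c * (Real.exp ((ρ + ε) * (-ε)) / (ρ + ε)) - ε) (𝓝[>] 0)
      (𝓝 (c / ρ)) := by
    have : ContinuousAt (fun ε : ℝ => c * (Real.exp ((ρ + ε) * (-ε)) / (ρ + ε)) - ε) 0 := by
      refine ContinuousAt.sub (ContinuousAt.mul continuousAt_const
        (ContinuousAt.div (by fun_prop) (by fun_prop) (by simpa using hρ.ne'))) continuousAt_id
    have h2 := this.tendsto.mono_left (nhdsWithin_le_nhds (s := Ioi 0))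
    simpa [div_eq_mul_inv] using h2
  refine tendsto_order.2 ⟨fun m hm => ?_, fun m hm => ?_⟩
  · obtain ⟨ε, h1, hε⟩ := ((hcL.eventually_const_lt hm).and self_mem_nhdsWithin).exists
    exact (hlower hε).mono fun u hu => h1.trans hu
  · obtain ⟨ε, h1, hε⟩ := ((hcU.eventually_lt_const hm).and self_mem_nhdsWithin).exists
    exact (hupper hε).mono fun u hu => hu.trans h1

end

/-- **Delange's Tauberian theorem** (including the extension to the case `A ρ = 0`).

Let `G(s) = ∑_{N=1}^∞ a_N N^{-s}` be a Dirichlet series, `ρ > 0`, `β > 0`.  Assume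
(i) `a_N ≥ 0`; (ii) the series converges to `G s` for `Re s > ρ`; (iii) `G` extends to a
function analytic at every point of the closed half-plane `Re s ≥ ρ` except possibly `ρ`;
(iv) on a neighborhood of `ρ` there are functions `A`, `B` analytic at `ρ` with
`G s = A s / (s - ρ)^β + B s` whenever `Re s > ρ` (principal branch).  Then
`∑_{N ≤ x} a_N = (A(ρ)/(ρ Γ(β)) + o(1)) · x^ρ (log x)^{β-1}` as `x → ∞`, which is
expressed below as convergence of the quotient; in particular if `A ρ = 0` the partial
sums are `o(x^ρ (log x)^{β-1})`. -/
theorem delange_tauberian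
    (a : ℕ → ℝ) (ρ β : ℝ) (hρ : 0 < ρ) (hβ : 0 < β) (G : ℂ → ℂ)
    (ha : ∀ N, 0 ≤ a N)
    (hconv : ∀ s : ℂ, ρ < s.re →
      HasSum (fun N : ℕ => (a N : ℂ) * (N : ℂ) ^ (-s)) (G s))
    (hext : ∃ F : ℂ → ℂ, (∀ s : ℂ, ρ < s.re → F s = G s) ∧
      ∀ s : ℂ, ρ ≤ s.re → s ≠ (ρ : ℂ) → AnalyticAt ℂ F s)
    (A B : ℂ → ℂ) (hA : AnalyticAt ℂ A (ρ : ℂ)) (hB : AnalyticAt ℂ B (ρ : ℂ))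
    (hAB : ∀ᶠ s : ℂ in 𝓝 (ρ : ℂ), ρ < s.re →
      G s = A s / (s - (ρ : ℂ)) ^ (β : ℂ) + B s) :
    Tendsto
      (fun x : ℝ =>
        ((∑ N ∈ Finset.Icc 1 ⌊x⌋₊, a N : ℝ) : ℂ) /
          ((x ^ ρ * Real.log x ^ (β - 1) : ℝ) : ℂ))
      atTop (𝓝 (A (ρ : ℂ) / ((ρ * Real.Gamma β : ℝ) : ℂ))) := by
  obtain ⟨F, hFG, hF⟩ := hext
  obtain ⟨c, hc0, hc, h⟩ := tendsto_tsum_of_cpow_singularity hρ hβ ha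
    (fun s hs => by rw [hFG s hs]; exact hconv s hs) hF hA hB
    (hAB.mono fun s hs hs' => by rw [hFG s hs', hs hs'])
  have hlim := (tendsto_sum_of_tendsto_tsum hρ ha hc0 h).comp Real.tendsto_log_atTop
  have hval : A (ρ : ℂ) / ((ρ * Real.Gamma β : ℝ) : ℂ) = ((c / ρ : ℝ) : ℂ) := by
    have := (Real.Gamma_pos_of_pos hβ).ne'
    rw [hc, ← Complex.ofReal_div]
    congr 1
    field_simp
  rw [hval]
  refine ((Complex.continuous_ofReal.tendsto _).comp hlim).congr' ?_
  filter_upwards [eventually_gt_atTop 1] with x hx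
  have hx0 : 0 < x := by linarith
  have hl : 0 < Real.log x := Real.log_pos hx
  simp only [Function.comp_apply]
  rw [← Complex.ofReal_div, Real.exp_log hx0, Real.rpow_def_of_pos hx0 ρ, mul_comm ρ,
    Real.exp_neg, show 1 - β = -(β - 1) by ring, Real.rpow_neg hl.le, ← mul_inv, mul_comm,
    mul_comm (Real.log x ^ (β - 1)), div_eq_mul_inv]
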